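/- arXiv:2108.01410 — 4 statements merged into one kernel-verified Lean document; each statement's English description precedes it below -/
import Mathlib

section
/- Let G be a finite connected simple graph with edge set E that is 2-edge-connected (deleting any single edge of G leaves it connected). Let P_U ⊆ ℝ^E be the convex hull of the indicator vectors 1_{E∖T} where T ranges over edge sets of spanning trees of G, and let Δ̃_E = conv({0} ∪ {e_e : e ∈ E}) be the standard simplex with the origin adjoined. Then the Minkowski sum P_G = P_U + Δ̃_E has the integer decomposition property (IDP): for every integer k ≥ 1, (k·P_G) ∩ ℤ^E = ((k−1)·P_G ∩ ℤ^E) + (P_G ∩ ℤ^E). -/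
open scoped Pointwise
open Classical

noncomputable section

/-- `T` is the edge set of a spanning tree of `G`. -/
def IsSpanningTreeEdges {V : Type*} (G : SimpleGraph V) (T : Set (Sym2 V)) : Prop :=
  T ⊆ G.edgeSet ∧ (SimpleGraph.fromEdgeSet T).IsTree

/-- The indicator vector of `E ∖ S` in `ℝ^E`, where `E` is the edge set of `G`. -/
def coIndicator {V : Type*} (G : SimpleGraph V) (S : Set (Sym2 V)) : G.edgeSet → ℝ :=
  fun e => if (e : Sym2 V) ∈ S then 0 else 1

/-- The standard basis vector indexed by `f`. -/
def stdVec {ι : Type*} (f : ι) : ι → ℝ := fun e => if e = f then 1 else 0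

/-- `x` is a lattice point (all coordinates are integers). -/
def IsLatticePt {ι : Type*} (x : ι → ℝ) : Prop := ∀ i, ∃ n : ℤ, x i = (n : ℝ)

/-- The integer decomposition property for a set `P ⊆ ℝ^ι`. -/
def HasIDP {ι : Type*} (P : Set (ι → ℝ)) : Prop :=
  ∀ k : ℕ, 1 ≤ k →
    ((k : ℝ) • P) ∩ {x | IsLatticePt x} =
      ((((k - 1 : ℕ) : ℝ) • P) ∩ {x | IsLatticePt x}) + (P ∩ {x | IsLatticePt x})


/-- An edge of a tree that is missing from a connected graph `H` can be replaced by an edge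
of `H`. -/
theorem SimpleGraph.IsTree.exists_exchange {V : Type*} {T H : SimpleGraph V} (hT : T.IsTree)
    (hH : H.Connected) {u v : V} (huv : T.Adj u v) (hn : ¬ H.Adj u v) :
    ∃ p q, H.Adj p q ∧ ¬ T.Adj p q ∧
      (T.deleteEdges {s(u, v)} ⊔ SimpleGraph.edge p q).IsTree := by
  set D := T.deleteEdges {s(u, v)} with hD
  have hnr : ¬ D.Reachable u v :=
    SimpleGraph.isAcyclic_iff_forall_isBridge.mp hT.isAcyclic (e := s(u, v)) huv
  have hcover : ∀ w, D.Reachable u w ∨ D.Reachable v w := by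
    intro w
    by_contra hw
    obtain ⟨W⟩ := hT.connected.preconnected u w
    obtain ⟨d, -, hd1, hd2⟩ := W.exists_boundary_dart {w | D.Reachable u w ∨ D.Reachable v w}
      (Or.inl (SimpleGraph.Reachable.refl u)) hw
    by_cases he : s(d.fst, d.snd) = s(u, v)
    · rcases Sym2.eq_iff.mp he with ⟨-, h⟩ | ⟨-, h⟩
      · exact hd2 (Or.inr (h ▸ SimpleGraph.Reachable.refl _))
      · exact hd2 (Or.inl (h ▸ SimpleGraph.Reachable.refl _))
    · have hadj : D.Adj d.fst d.snd := by
        rw [hD, SimpleGraph.deleteEdges_adj]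
        exact ⟨d.adj, he⟩
      exact hd2 (hd1.imp (fun h => h.trans hadj.reachable) (fun h => h.trans hadj.reachable))
  obtain ⟨W⟩ := hH.preconnected u v
  obtain ⟨⟨⟨p, q⟩, hpq⟩, -, hp, hq⟩ := W.exists_boundary_dart {w | D.Reachable u w}
    (SimpleGraph.Reachable.refl u) hnr
  simp only [Set.mem_ofPred_eq] at hp hq hpq
  have hpqn : ¬ D.Reachable p q := fun h => hq (hp.trans h)
  refine ⟨p, q, hpq, fun h => ?_, ⟨?_, ?_⟩⟩
  · by_cases he : s(p, q) = s(u, v)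
    · exact hn (by rwa [← SimpleGraph.mem_edgeSet, ← he, SimpleGraph.mem_edgeSet])
    · refine hpqn (SimpleGraph.Adj.reachable ?_)
      rw [hD, SimpleGraph.deleteEdges_adj]
      exact ⟨h, he⟩
  · have hle : D ≤ D ⊔ SimpleGraph.edge p q := le_sup_left
    have hpq' : (D ⊔ SimpleGraph.edge p q).Reachable p q := by
      refine SimpleGraph.Adj.reachable ?_
      rw [SimpleGraph.sup_adj, SimpleGraph.edge_adj]
      exact Or.inr ⟨by simp, hpq.ne⟩
    have hqv := (hcover q).resolve_left hq
    have huv' := ((hp.mono hle).trans hpq').trans (hqv.symm.mono hle)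
    have := hH.nonempty
    have hall : ∀ w, (D ⊔ SimpleGraph.edge p q).Reachable u w := fun w =>
      (hcover w).elim (fun h => h.mono hle) fun h => huv'.trans (h.mono hle)
    exact { preconnected := fun a b => (hall a).symm.trans (hall b) }
  · exact (hT.isAcyclic.anti (SimpleGraph.deleteEdges_le _)).sup_edge_of_not_reachable hpqn

theorem spanningTree_exchangeProperty {V : Type*} (G : SimpleGraph V) :
    Matroid.ExchangeProperty fun B : Set G.edgeSet =>
      (SimpleGraph.fromEdgeSet (Subtype.val '' B)).IsTree := by
  rintro X Y hX hY ⟨a, ha⟩ ⟨haX, haY⟩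
  induction a with | _ u v => ?_
  have hne : u ≠ v := G.ne_of_adj ha
  obtain ⟨p, q, h1, h2, h3⟩ := hX.exists_exchange hY.connected (u := u) (v := v)
    (by rw [SimpleGraph.fromEdgeSet_adj]; exact ⟨⟨_, haX, rfl⟩, hne⟩)
    (by
      rw [SimpleGraph.fromEdgeSet_adj]
      rintro ⟨⟨e, he, h⟩, -⟩
      exact haY (by convert he; exact h.symm))
  rw [SimpleGraph.fromEdgeSet_adj] at h1 h2
  obtain ⟨⟨b, hbY, hb⟩, hpq⟩ := h1
  refine ⟨b, ⟨hbY, fun hbX => h2 ⟨⟨b, hbX, hb⟩, hpq⟩⟩, ?_⟩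
  convert h3 using 1
  ext x y
  simp only [SimpleGraph.sup_adj, SimpleGraph.deleteEdges_adj, SimpleGraph.edge,
    SimpleGraph.fromEdgeSet_adj, Set.image_insert_eq, Set.mem_insert_iff, Set.mem_singleton_iff,
    Set.image_sdiff Subtype.val_injective, Set.image_singleton, Set.mem_sdiff, hb]
  tauto

/-- The graphic matroid of a connected graph: the bases are the spanning trees. -/
def graphicMatroid {V : Type*} [Finite V] (G : SimpleGraph V) (hG : G.Connected) :
    Matroid G.edgeSet :=
  Matroid.ofIsBaseOfFinite (E := Set.univ) Set.finite_univ
    (fun B => (SimpleGraph.fromEdgeSet (Subtype.val '' B)).IsTree)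
    (by
      obtain ⟨T, hT, hT'⟩ := hG.exists_isTree_le
      refine ⟨Subtype.val ⁻¹' T.edgeSet, ?_⟩
      rwa [Subtype.image_preimage_coe, Set.inter_eq_right.mpr (SimpleGraph.edgeSet_mono hT),
        SimpleGraph.fromEdgeSet_edgeSet])
    (spanningTree_exchangeProperty G) (fun _ _ => Set.subset_univ _)

theorem dual_graphicMatroid_isBase_iff {V : Type*} [Finite V] (G : SimpleGraph V)
    (hG : G.Connected) (B : Set G.edgeSet) :
    (graphicMatroid G hG)✶.IsBase B ↔ IsSpanningTreeEdges G (Subtype.val '' Bᶜ) := by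
  rw [Matroid.dual_isBase_iff (Set.subset_univ B), Set.compl_eq_univ_sdiff]
  exact ⟨fun h => ⟨Subtype.coe_image_subset _ _, h⟩, fun h => h.2⟩

section BasePacking

variable {α : Type*}

/-- Replacing `a` by `b` in the base `B` gives a base. -/
def Matroid.Exchange (M : Matroid α) (B : Set α) (a b : α) : Prop :=
  a ∈ B ∧ b ∉ B ∧ M.IsBase (insert b (B \ {a}))

/-- Exchanges are preserved by a further exchange `a ↦ b` that creates no shortcut. -/
theorem Matroid.Exchange.of_exchange {M : Matroid α} {B : Set α} (hB : M.IsBase B) {a b e f : α}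
    (hab : M.Exchange B a b) (hef : M.Exchange B e f) (heb : ¬ M.Exchange B e b)
    (hea : e ≠ a) (hfb : f ≠ b) : M.Exchange (insert b (B \ {a})) e f := by
  obtain ⟨ha, hb, hbase⟩ := hab
  obtain ⟨he, hf, hbase'⟩ := hef
  have hbE : b ∈ M.E := hbase.subset_ground (Set.mem_insert _ _)
  have hbcl : b ∈ M.closure (B \ {e}) := by
    by_contra h
    exact heb ⟨he, hb, hB.exchange_base_of_notMem_closure he h⟩
  have hfcl : f ∉ M.closure (B \ {e}) := by
    have := (hB.indep.sdiff {e}).insert_indep_iff_of_notMem (e := f) (fun h => hf h.1)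
    exact (this.mp hbase'.indep).2
  have heB' : e ∈ insert b (B \ {a}) := Or.inr ⟨he, hea⟩
  have hfE : f ∈ M.E := hbase'.subset_ground (Set.mem_insert _ _)
  refine ⟨heB', by simp [hf, hfb], hbase.exchange_base_of_notMem_closure heB' fun h => hfcl ?_⟩
  refine M.closure_subset_closure_of_subset_closure ?_ h
  rintro x ⟨rfl | hx, hxe⟩
  · exact hbcl
  · exact M.mem_closure_of_mem' ⟨hx.1, hxe⟩ (hB.subset_ground hx.1)

/-- If no exchange of the base `B` leads from `R` to its complement, then `B` has the least
possible intersection with `R`. -/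
theorem Matroid.IsBase.ncard_inter_le_of_closed [Finite α] {M : Matroid α} {B C : Set α}
    (hB : M.IsBase B) (hC : M.IsBase C) {R : Set α}
    (hR : ∀ a b, M.Exchange B a b → a ∈ R → b ∈ R) : (B ∩ R).ncard ≤ (C ∩ R).ncard := by
  have hspan : C \ R ⊆ M.closure (B \ R) := by
    rintro f ⟨hfC, hfR⟩
    by_contra hf
    have hfE := hC.subset_ground hfC
    have hfBR : f ∉ B \ R :=
      fun h => hf (M.mem_closure_of_mem h (Set.sdiff_subset.trans hB.subset_ground))
    have hfB : f ∉ B := fun h => hfBR ⟨h, hfR⟩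
    have hind : M.Indep (insert f (B \ R)) :=
      ((hB.indep.sdiff R).insert_indep_iff_of_notMem hfBR).mpr ⟨hfE, hf⟩
    obtain ⟨B', hB', h1, h2⟩ := hind.exists_isBase_subset_union_isBase hB
    have hfB' : f ∈ B' := h1 (Set.mem_insert _ _)
    obtain ⟨e, heB, heB'⟩ : ∃ e ∈ B, e ∉ B' := by
      by_contra! h
      have := hB.eq_of_subset_isBase hB' h
      exact hfB (this ▸ hfB')
    have heR : e ∈ R := by
      by_contra h
      exact heB' (h1 (Or.inr ⟨heB, h⟩))
    refine hfR (hR e f ⟨heB, hfB, ?_⟩ heR)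
    have hsub : B' ⊆ insert f (B \ {e}) := by
      intro x hx
      rcases h2 hx with (rfl | h) | h
      · exact Set.mem_insert _ _
      · exact Or.inr ⟨h.1, fun h' => heB' (h' ▸ hx)⟩
      · exact Or.inr ⟨h, fun h' => heB' (h' ▸ hx)⟩
    have hfin : (insert f (B \ {e})).Finite := Set.toFinite _
    rwa [← Set.eq_of_subset_of_ncard_le hsub ?_ hfin]
    rw [Set.ncard_exchange hfB heB, hB.ncard_eq_ncard_of_isBase hB']
  have hle : (C \ R).encard ≤ (B \ R).encard := by
    refine ((hC.indep.sdiff R).encard_le_eRk_of_subset hspan).trans ?_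
    rw [M.eRk_closure_eq]
    exact M.eRk_le_encard _
  rw [← Set.Finite.cast_ncard_eq (Set.toFinite _), ← Set.Finite.cast_ncard_eq (Set.toFinite _),
    Nat.cast_le] at hle
  have h1 := Set.ncard_inter_add_ncard_sdiff_eq_ncard B R
  have h2 := Set.ncard_inter_add_ncard_sdiff_eq_ncard C R
  have h3 := hB.ncard_eq_ncard_of_isBase hC
  omega

/-- The number of members of the family `B` that contain `e`. -/
def coverCount {ι : Type*} [Fintype ι] (B : ι → Set α) (e : α) : ℤ :=
  ∑ i, if e ∈ B i then 1 else 0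

/-- The total amount by which `c` exceeds `x`. -/
def excess [Fintype α] (x c : α → ℤ) : ℕ := ∑ e, (c e - x e).toNat

theorem excess_exchange_le [Fintype α] {x c c' : α → ℤ} {a b : α} (hab : a ≠ b) (hb : c b < x b)
    (hc : ∀ e, c' e = c e + (if e = b then 1 else 0) - if e = a then 1 else 0) :
    excess x c' ≤ excess x c ∧ (x a < c a → excess x c' < excess x c) := by
  have hle : ∀ e, (c' e - x e).toNat ≤ (c e - x e).toNat := by
    intro e
    rw [hc e]
    by_cases h : e = b
    · subst h
      simp only [if_true, hab.symm, if_false]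
      omega
    · simp only [h, if_false]
      split_ifs <;> omega
  refine ⟨Finset.sum_le_sum fun e _ => hle e, fun ha =>
    Finset.sum_lt_sum (fun e _ => hle e) ⟨a, Finset.mem_univ a, ?_⟩⟩
  rw [hc a]
  simp only [if_true, hab, if_false]
  omega

theorem coverCount_update_exchange {ι : Type*} [Fintype ι] (B : ι → Set α) (i : ι) {a b : α}
    (ha : a ∈ B i) (hb : b ∉ B i) (e : α) :
    coverCount (Function.update B i (insert b (B i \ {a}))) e =
      coverCount B e + (if e = b then 1 else 0) - if e = a then 1 else 0 := by
  have hab : a ≠ b := fun h => hb (h ▸ ha)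
  unfold coverCount
  rw [← Finset.add_sum_erase _ _ (Finset.mem_univ i),
    ← Finset.add_sum_erase (a := i) _ (fun j => if e ∈ B j then (1 : ℤ) else 0)
      (Finset.mem_univ i)]
  have hrest : ∑ j ∈ Finset.univ.erase i,
      (if e ∈ Function.update B i (insert b (B i \ {a})) j then (1 : ℤ) else 0) =
      ∑ j ∈ Finset.univ.erase i, if e ∈ B j then (1 : ℤ) else 0 := by
    refine Finset.sum_congr rfl fun j hj => ?_
    rw [Function.update_of_ne (Finset.ne_of_mem_erase hj)]
  rw [hrest, Function.update_self]
  by_cases h1 : e = b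
  · subst h1
    simp [hb, hab.symm]
    ring
  · by_cases h2 : e = a
    · subst h2
      simp [ha, hab]
    · simp [h1, h2]

/-- An exchange path from an element covered too often to one covered too rarely allows the family
of bases to be improved. -/
theorem exists_excess_lt_of_path [Fintype α] {ι : Type*} [Fintype ι] (M : Matroid α) (x : α → ℤ)
    (p : ℕ → α) (m : ℕ) (B : ι → Set α) (hB : ∀ i, M.IsBase (B i))
    (h0 : x (p 0) < coverCount B (p 0)) (hm : coverCount B (p m) < x (p m))
    (hp : ∀ j < m, ∃ i, M.Exchange (B i) (p j) (p (j + 1))) :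
    ∃ B' : ι → Set α, (∀ i, M.IsBase (B' i)) ∧
      excess x (coverCount B') < excess x (coverCount B) := by
  induction m using Nat.strong_induction_on generalizing p B with
  | _ m ih =>
  obtain _ | m := m
  · omega
  by_cases hshort : ∃ j < m, ∃ i, M.Exchange (B i) (p j) (p (m + 1))
  · obtain ⟨j, hj, hex⟩ := hshort
    refine ih (j + 1) (by omega) (Function.update p (j + 1) (p (m + 1))) B hB (by simpa using h0)
      (by simpa using hm) fun l hl => ?_
    rw [Function.update_of_ne (by omega)]
    by_cases hlj : l = j
    · subst hlj
      simpa using hex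
    · rw [Function.update_of_ne (by omega)]
      exact hp l (by omega)
  by_cases hrep : ∃ j ≤ m, p j = p (m + 1)
  · obtain ⟨j, hj, hex⟩ := hrep
    exact ih j (by omega) p B hB h0 (hex ▸ hm) fun l hl => hp l (by omega)
  push Not at hshort hrep
  obtain ⟨i, hi⟩ := hp m (by omega)
  have hne : p m ≠ p (m + 1) := hrep m le_rfl
  have hcount := coverCount_update_exchange B i hi.1 hi.2.1
  have hbase : ∀ k, M.IsBase (Function.update B i (insert (p (m + 1)) (B i \ {p m})) k) := by
    intro k
    by_cases hk : k = i
    · subst hk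
      simpa using hi.2.2
    · simpa [hk] using hB k
  obtain ⟨hle, hlt⟩ := excess_exchange_le hne hm hcount
  rcases lt_trichotomy (coverCount B (p m)) (x (p m)) with h | h | h
  · exact ih m (by omega) p B hB h0 h fun l hl => hp l (by omega)
  · have h0m : p 0 ≠ p m := fun h' => by rw [h'] at h0; omega
    obtain ⟨B', hB', hlt'⟩ := ih m (by omega) p _ hbase
      (by
        rw [hcount, if_neg (hrep 0 (by omega)), if_neg h0m]
        simpa using h0)
      (by
        rw [hcount, if_neg hne, if_pos rfl]
        omega)
      fun l hl => by
        obtain ⟨k, hk⟩ := hp l (by omega)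
        refine ⟨k, ?_⟩
        by_cases hki : k = i
        · subst hki
          rw [Function.update_self]
          refine hi.of_exchange (hB k) hk (hshort l hl k) (fun h' => ?_) (hrep (l + 1) (by omega))
          exact hshort l hl k (h' ▸ hi)
        · rwa [Function.update_of_ne hki]
    exact ⟨B', hB', hlt'.trans_le hle⟩
  · exact ⟨_, hbase, hlt h⟩

theorem coverCount_sum [Fintype α] {ι : Type*} [Fintype ι] (B : ι → Set α) (R : Set α) :
    ∑ e ∈ R.toFinset, coverCount B e = ∑ i, ((B i ∩ R).ncard : ℤ) := by
  unfold coverCount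
  rw [Finset.sum_comm]
  refine Finset.sum_congr rfl fun i _ => ?_
  rw [Finset.sum_boole, Set.ncard_eq_toFinset_card']
  congr 2
  ext e
  simp [and_comm]

/-- **Base packing.** If the sum of `x` over every set `R` is at least `k` times the least size of
the intersection of `R` with a base, then `x` dominates a sum of `k` bases. -/
theorem Matroid.exists_base_packing [Fintype α] (M : Matroid α) (x : α → ℤ) (k : ℕ)
    (hx : ∀ R : Set α, ∀ n : ℕ, (∀ C, M.IsBase C → n ≤ (C ∩ R).ncard) →
      (k * n : ℤ) ≤ ∑ e ∈ R.toFinset, x e) :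
    ∃ B : Fin k → Set α, (∀ i, M.IsBase (B i)) ∧ ∀ e, coverCount B e ≤ x e := by
  obtain ⟨B₀, hB₀⟩ := M.exists_isBase
  let S := {B : Fin k → Set α // ∀ i, M.IsBase (B i)}
  have : Nonempty S := ⟨⟨fun _ => B₀, fun _ => hB₀⟩⟩
  obtain ⟨⟨B, hB⟩, hmin⟩ : ∃ B : S, ∀ B' : S,
      excess x (coverCount B.1) ≤ excess x (coverCount B'.1) :=
    ⟨Function.argmin fun B : S => excess x (coverCount B.1),
      fun B' => Function.argmin_le (fun B : S => excess x (coverCount B.1)) B'⟩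
  refine ⟨B, hB, fun e₀ => ?_⟩
  by_contra! he₀
  let R : Set α := {f | ∃ m, ∃ p : ℕ → α, p 0 = e₀ ∧ p m = f ∧
    ∀ j < m, ∃ i, M.Exchange (B i) (p j) (p (j + 1))}
  have he₀R : e₀ ∈ R := ⟨0, fun _ => e₀, rfl, rfl, by simp⟩
  have hclosed : ∀ i a b, M.Exchange (B i) a b → a ∈ R → b ∈ R := by
    rintro i a b hab ⟨m, p, hp0, hpm, hp⟩
    refine ⟨m + 1, Function.update p (m + 1) b, by simpa using hp0, by simp, fun j hj => ?_⟩
    rw [Function.update_of_ne (by omega)]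
    by_cases hjm : j = m
    · subst hjm
      exact ⟨i, by simpa [hpm] using hab⟩
    · rw [Function.update_of_ne (by omega)]
      exact hp j (by omega)
  have hfull : ∀ f ∈ R, x f ≤ coverCount B f := by
    rintro f ⟨m, p, rfl, rfl, hp⟩
    by_contra! h
    obtain ⟨B', hB', hlt⟩ := exists_excess_lt_of_path M x p m B hB he₀ h hp
    exact absurd (hmin ⟨B', hB'⟩) (not_le.mpr hlt)
  have hlt : ∑ e ∈ R.toFinset, x e < ∑ e ∈ R.toFinset, coverCount B e :=
    Finset.sum_lt_sum (fun f hf => hfull f (Set.mem_toFinset.mp hf))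
      ⟨e₀, Set.mem_toFinset.mpr he₀R, he₀⟩
  rw [coverCount_sum] at hlt
  obtain rfl | hk := Nat.eq_zero_or_pos k
  · have := hx R 0 (fun _ _ => Nat.zero_le _)
    simp at hlt this
    omega
  have hconst : ∀ i, (B i ∩ R).ncard = (B ⟨0, hk⟩ ∩ R).ncard := fun i =>
    le_antisymm ((hB i).ncard_inter_le_of_closed (hB _) (hclosed i))
      ((hB _).ncard_inter_le_of_closed (hB i) (hclosed _))
  have := hx R (B ⟨0, hk⟩ ∩ R).ncard fun C hC =>
    (hB _).ncard_inter_le_of_closed hC (hclosed _)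
  simp only [hconst, Finset.sum_const, Finset.card_univ, Fintype.card_fin, nsmul_eq_mul] at hlt
  omega

end BasePacking

section IDP

variable {ι : Type*}

/-- The indicator vectors of the bases of a matroid. -/
def Matroid.baseVectors (M : Matroid ι) : Set (ι → ℝ) :=
  {x | ∃ B, M.IsBase B ∧ x = fun e => if e ∈ B then 1 else 0}

/-- The standard simplex with the origin adjoined. -/
def cornerSimplex (ι : Type*) : Set (ι → ℝ) :=
  convexHull ℝ ({0} ∪ {x | ∃ f, x = stdVec f})

theorem Convex.natCast_succ_smul {C : Set (ι → ℝ)} (hC : Convex ℝ C) (n : ℕ) :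
    ((n + 1 : ℕ) : ℝ) • C = (n : ℝ) • C + C := by
  rw [Nat.cast_succ, hC.add_smul n.cast_nonneg zero_le_one, one_smul]

theorem Convex.sum_mem_natCast_smul {C : Set (ι → ℝ)} (hC : Convex ℝ C) (hne : C.Nonempty) {n : ℕ}
    (f : Fin n → ι → ℝ) (hf : ∀ i, f i ∈ C) : ∑ i, f i ∈ (n : ℝ) • C := by
  induction n with
  | zero =>
    rw [Nat.cast_zero, Set.zero_smul_set hne]
    simp
  | succ n ih =>
    rw [hC.natCast_succ_smul, Fin.sum_univ_castSucc]
    exact Set.add_mem_add (ih _ fun i => hf _) (hf _)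

theorem isLatticePt_intCast (z : ι → ℤ) : IsLatticePt fun i => (z i : ℝ) := fun i => ⟨z i, rfl⟩

theorem IsLatticePt.add {x y : ι → ℝ} (hx : IsLatticePt x) (hy : IsLatticePt y) :
    IsLatticePt (x + y) := by
  intro i
  obtain ⟨a, ha⟩ := hx i
  obtain ⟨b, hb⟩ := hy i
  exact ⟨a + b, by simp [ha, hb]⟩

theorem convex_cornerSimplex : Convex ℝ (cornerSimplex ι) := convex_convexHull ℝ _

theorem nonneg_and_sum_le_one_of_mem_cornerSimplex [Fintype ι] {d : ι → ℝ}
    (hd : d ∈ cornerSimplex ι) : (∀ e, 0 ≤ d e) ∧ ∑ e, d e ≤ 1 := by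
  have hconv : Convex ℝ {d : ι → ℝ | (∀ e, 0 ≤ d e) ∧ ∑ e, d e ≤ 1} := by
    rintro a ⟨ha, ha'⟩ b ⟨hb, hb'⟩ s t hs ht hst
    refine ⟨fun e => ?_, ?_⟩
    · exact add_nonneg (mul_nonneg hs (ha e)) (mul_nonneg ht (hb e))
    · simp only [Pi.add_apply, Pi.smul_apply, smul_eq_mul, Finset.sum_add_distrib,
        ← Finset.mul_sum]
      nlinarith
  refine convexHull_min ?_ hconv hd
  rintro _ (rfl | ⟨f, rfl⟩)
  · simp
  · refine ⟨fun e => ?_, by simp [stdVec]⟩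
    unfold stdVec
    split_ifs <;> norm_num

/-- A lattice point of a dilated corner simplex loses one vertex. -/
theorem exists_eq_add_cornerSimplex [Fintype ι] {z : ι → ℤ} (hz : ∀ e, 0 ≤ z e) {n : ℕ}
    (hn : ∑ e, z e ≤ n + 1) : ∃ z' w : ι → ℤ, z = z' + w ∧ (∀ e, 0 ≤ z' e) ∧ ∑ e, z' e ≤ n ∧
      (fun e => (w e : ℝ)) ∈ cornerSimplex ι := by
  by_cases h : ∃ f, 0 < z f
  · obtain ⟨f, hf⟩ := h
    refine ⟨z - Pi.single f 1, Pi.single f 1, by simp, fun e => ?_, ?_, ?_⟩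
    · by_cases hef : e = f
      · subst hef
        simpa [Int.le_iff_lt_add_one] using hf
      · simpa [hef] using hz e
    · simp only [Pi.sub_apply, Finset.sum_sub_distrib, Finset.sum_pi_single', Finset.mem_univ,
        if_true]
      omega
    · refine subset_convexHull ℝ _ (Or.inr ⟨f, ?_⟩)
      ext e
      simp [stdVec, Pi.single_apply]
  · push Not at h
    have h0 : z = 0 := funext fun e => le_antisymm (h e) (hz e)
    refine ⟨0, 0, by simp [h0], by simp, by simp, subset_convexHull ℝ _ (Or.inl ?_)⟩
    ext e
    simp

theorem intCast_mem_smul_cornerSimplex [Fintype ι] {z : ι → ℤ} (hz : ∀ e, 0 ≤ z e) {n : ℕ}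
    (hn : ∑ e, z e ≤ n) : (fun e => (z e : ℝ)) ∈ (n : ℝ) • cornerSimplex ι := by
  induction n generalizing z with
  | zero =>
    have hsum : ∑ e, z e = 0 :=
      le_antisymm (by simpa using hn) (Finset.sum_nonneg fun e _ => hz e)
    have h0 : ∀ e, z e = 0 := fun e =>
      (Finset.sum_eq_zero_iff_of_nonneg fun e _ => hz e).mp hsum e (Finset.mem_univ e)
    have hne : (cornerSimplex ι).Nonempty := ⟨0, subset_convexHull ℝ _ (by simp)⟩
    rw [Nat.cast_zero, Set.zero_smul_set hne]
    ext e
    simp [h0 e]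
  | succ n ih =>
    obtain ⟨z', w, rfl, h1, h2, h3⟩ := exists_eq_add_cornerSimplex hz (n := n) (by simpa using hn)
    rw [convex_cornerSimplex.natCast_succ_smul]
    exact ⟨_, ih h1 h2, _, h3, by ext e; simp⟩

theorem Matroid.le_sum_of_mem_convexHull_baseVectors [Fintype ι] {M : Matroid ι} {u : ι → ℝ}
    (hu : u ∈ convexHull ℝ M.baseVectors) (R : Set ι) (n : ℕ)
    (h : ∀ C, M.IsBase C → n ≤ (C ∩ R).ncard) : (n : ℝ) ≤ ∑ e ∈ R.toFinset, u e := by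
  have hconv : Convex ℝ {u : ι → ℝ | (n : ℝ) ≤ ∑ e ∈ R.toFinset, u e} := by
    refine convex_halfSpace_ge (f := fun u : ι → ℝ => ∑ e ∈ R.toFinset, u e)
      ⟨fun a b => ?_, fun c a => ?_⟩ _
    · simp [Finset.sum_add_distrib]
    · simp [Finset.mul_sum]
  refine convexHull_min ?_ hconv hu
  rintro _ ⟨B, hB, rfl⟩
  have hcard := coverCount_sum (fun _ : Unit => B) R
  simp only [coverCount, Finset.univ_unique, Finset.sum_singleton] at hcard
  have hB' : (n : ℤ) ≤ ((B ∩ R).ncard : ℤ) := by exact_mod_cast h B hB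
  rw [← hcard] at hB'
  have : ((n : ℤ) : ℝ) ≤ ((∑ e ∈ R.toFinset, if e ∈ B then (1 : ℤ) else 0 : ℤ) : ℝ) := by
    exact_mod_cast hB'
  simpa using this

/-- The sum of a matroid base polytope and the corner simplex has the integer decomposition
property. -/
theorem Matroid.hasIDP_convexHull_baseVectors_add [Fintype ι] (M : Matroid ι) :
    HasIDP (convexHull ℝ M.baseVectors + cornerSimplex ι) := by
  intro k hk
  obtain ⟨n, rfl⟩ := Nat.exists_eq_add_of_le' hk
  have hU : Convex ℝ (convexHull ℝ M.baseVectors) := convex_convexHull ℝ _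
  rw [Nat.add_sub_cancel]
  apply Set.Subset.antisymm
  swap
  · rintro _ ⟨a, ⟨ha, ha'⟩, b, ⟨hb, hb'⟩, rfl⟩
    refine ⟨?_, ha'.add hb'⟩
    rw [(hU.add convex_cornerSimplex).natCast_succ_smul]
    exact Set.add_mem_add ha hb
  rintro _ ⟨⟨_, ⟨u, hu, d, hd, rfl⟩, rfl⟩, hlat⟩
  choose x hx using hlat
  simp only [Pi.smul_apply, Pi.add_apply, smul_eq_mul] at hx
  obtain ⟨hd0, hd1⟩ := nonneg_and_sum_le_one_of_mem_cornerSimplex hd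
  have hk0 : (0 : ℝ) ≤ ((n + 1 : ℕ) : ℝ) := Nat.cast_nonneg _
  obtain ⟨B, hB, hBx⟩ := M.exists_base_packing x (n + 1) fun R m hm => by
    have h1 := M.le_sum_of_mem_convexHull_baseVectors hu R m hm
    have h2 : ∑ e ∈ R.toFinset, u e ≤ ∑ e ∈ R.toFinset, (u e + d e) :=
      Finset.sum_le_sum fun e _ => by linarith [hd0 e]
    have h3 : (((n + 1 : ℕ) * m : ℤ) : ℝ) ≤ ((∑ e ∈ R.toFinset, x e : ℤ) : ℝ) := by
      push_cast [← hx]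
      rw [← Finset.mul_sum]
      have := mul_le_mul_of_nonneg_left (h1.trans h2) hk0
      exact_mod_cast this
    exact_mod_cast h3
  set z : ι → ℤ := fun e => x e - coverCount B e with hz
  have hz0 : ∀ e, 0 ≤ z e := fun e => sub_nonneg.mpr (hBx e)
  have husum : ∑ e, u e = ((B 0).ncard : ℝ) := by
    have hconv : Convex ℝ {u : ι → ℝ | ∑ e, u e = ((B 0).ncard : ℝ)} := by
      refine convex_hyperplane (f := fun u : ι → ℝ => ∑ e, u e) ⟨fun a b => ?_, fun c a => ?_⟩ _
      · simp [Finset.sum_add_distrib]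
      · simp [Finset.mul_sum]
    refine convexHull_min ?_ hconv hu
    rintro _ ⟨C, hC, rfl⟩
    simp only [Set.mem_ofPred_eq]
    rw [Finset.sum_boole, hC.ncard_eq_ncard_of_isBase (hB 0) |>.symm, Set.ncard_eq_toFinset_card']
    congr 2
    ext e
    simp
  have hBsum : ∑ e, coverCount B e = (n + 1) * ((B 0).ncard : ℤ) := by
    have := coverCount_sum B Set.univ
    simp only [Set.toFinset_univ, Set.inter_univ,
      fun i => (hB i).ncard_eq_ncard_of_isBase (hB 0)] at this
    simpa using this
  have hzsum : ∑ e, z e ≤ n + 1 := by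
    have h1 : ((∑ e, x e : ℤ) : ℝ) ≤ (n + 1) * ((B 0).ncard + 1) := by
      push_cast [← hx]
      rw [← Finset.mul_sum, Finset.sum_add_distrib, husum]
      gcongr
    have h2 : ∑ e, x e ≤ (n + 1) * ((B 0).ncard + 1) := by exact_mod_cast h1
    rw [hz, Finset.sum_sub_distrib, hBsum]
    linarith
  obtain ⟨z', w, hzw, hz', hz's, hw⟩ := exists_eq_add_cornerSimplex hz0 hzsum
  let b : Fin (n + 1) → ι → ℤ := fun i e => if e ∈ B i then 1 else 0
  have hb : ∀ i, (fun e => (b i e : ℝ)) ∈ convexHull ℝ M.baseVectors := fun i =>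
    subset_convexHull ℝ _ ⟨B i, hB i, by ext e; simp [b]⟩
  refine ⟨(∑ i : Fin n, fun e => (b i.castSucc e : ℝ)) + fun e => (z' e : ℝ), ⟨?_, ?_⟩,
    (fun e => (b (Fin.last n) e : ℝ)) + fun e => (w e : ℝ), ⟨Set.add_mem_add (hb _) hw, ?_⟩, ?_⟩
  · rw [smul_add]
    exact Set.add_mem_add (hU.sum_mem_natCast_smul ⟨u, hu⟩ _ fun i => hb _)
      (intCast_mem_smul_cornerSimplex hz' hz's)
  · intro e
    exact ⟨∑ i : Fin n, b i.castSucc e + z' e, by simp [Finset.sum_apply]⟩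
  · exact (isLatticePt_intCast _).add (isLatticePt_intCast _)
  · ext e
    have h1 : z e = z' e + w e := congrFun hzw e
    have h2 : coverCount B e = ∑ i : Fin n, b i.castSucc e + b (Fin.last n) e :=
      Fin.sum_univ_castSucc _
    have h3 : x e = ∑ i : Fin n, b i.castSucc e + b (Fin.last n) e + (z' e + w e) := by
      rw [← h1, ← h2]
      simp [hz]
    simp only [Pi.add_apply, Finset.sum_apply, Pi.smul_apply, smul_eq_mul]
    rw [hx e, h3]
    push_cast
    ring

end IDP

/-- For a finite connected simple graph `G` that is 2-edge-connected,
the Minkowski sum `P_G = P_U + Δ̃_E` has the integer decomposition property. -/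
theorem massive_symanzik_polytope_IDP {V : Type*} [Fintype V] (G : SimpleGraph V)
    (hconn : G.Connected)
    (h2ec : ∀ e ∈ G.edgeSet, (G.deleteEdges {e}).Connected) :
    HasIDP
      ((convexHull ℝ {x : G.edgeSet → ℝ | ∃ T, IsSpanningTreeEdges G T ∧ x = coIndicator G T}) +
        convexHull ℝ ({0} ∪ {x : G.edgeSet → ℝ | ∃ f : G.edgeSet, x = stdVec f})) := by
  have hbases : {x : G.edgeSet → ℝ | ∃ T, IsSpanningTreeEdges G T ∧ x = coIndicator G T} =
      (graphicMatroid G hconn)✶.baseVectors := by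
    ext x
    constructor
    · rintro ⟨T, hT, rfl⟩
      refine ⟨(Subtype.val ⁻¹' T)ᶜ, ?_, ?_⟩
      · rwa [dual_graphicMatroid_isBase_iff, compl_compl, Subtype.image_preimage_coe,
          Set.inter_eq_right.mpr hT.1]
      · ext e
        simp [coIndicator]
    · rintro ⟨B, hB, rfl⟩
      refine ⟨Subtype.val '' Bᶜ, (dual_graphicMatroid_isBase_iff G hconn B).mp hB, ?_⟩
      ext e
      simp [coIndicator]
  rw [hbases]
  exact (graphicMatroid G hconn)✶.hasIDP_convexHull_baseVectors_add
end
end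

section
/- Let G be a finite connected simple graph with edge set E, let P_U ⊆ ℝ^E be the convex hull of the indicator vectors 1_{E∖T} over edge sets T of spanning trees of G, and let Δ̃_E = conv({0} ∪ {e_e : e ∈ E}). Then every edge (one-dimensional face) of the Minkowski sum P_G = P_U + Δ̃_E is parallel either to a standard basis vector e_i or to a difference e_i − e_j of standard basis vectors (i ≠ j); in particular the edge directions of P_G are among the columns of a unimodular matrix. -/
open scoped Pointwise
open Classical

noncomputable section

/-- `F` is the edge set of a spanning two-forest of `G`: a spanning subgraph that is
acyclic and has exactly two connected components. -/
def IsSpanningTwoForestEdges {V : Type*} (G : SimpleGraph V) (F : Set (Sym2 V)) : Prop :=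
  F ⊆ G.edgeSet ∧ (SimpleGraph.fromEdgeSet F).IsAcyclic ∧
    Nat.card (SimpleGraph.fromEdgeSet F).ConnectedComponent = 2

/-- Exchanging an edge of a finite tree for one joining the two sides gives a tree. -/
lemma SimpleGraph.IsTree.deleteEdges_sup_edge {V : Type*} [Finite V] {H : SimpleGraph V}
    (hH : H.IsTree) {e : Sym2 V} (he : e ∈ H.edgeSet) {x y : V}
    (hxy : ¬ (H.deleteEdges {e}).Reachable x y) :
    (H.deleteEdges {e} ⊔ SimpleGraph.edge x y).IsTree := by
  have hne : x ≠ y := by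
    rintro rfl
    exact hxy (SimpleGraph.Reachable.refl x)
  have hnot : s(x, y) ∉ (H.deleteEdges {e}).edgeSet := fun h =>
    hxy (SimpleGraph.Adj.reachable h)
  have hac : (H.deleteEdges {e} ⊔ SimpleGraph.edge x y).IsAcyclic :=
    (hH.isAcyclic.anti (H.deleteEdges_le {e})).sup_edge_of_not_reachable hxy
  have : Nonempty V := ⟨x⟩
  obtain ⟨F, hle, -, hF⟩ :=
    SimpleGraph.connected_top.exists_isTree_le_of_le_of_isAcyclic le_top hac
  have hcF := (SimpleGraph.isTree_iff_connected_and_card.1 hF).2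
  have hcH := (SimpleGraph.isTree_iff_connected_and_card.1 hH).2
  rw [Nat.card_coe_set_eq] at hcF hcH
  have hset : (H.deleteEdges {e} ⊔ SimpleGraph.edge x y).edgeSet =
      insert s(x, y) (H.edgeSet \ {e}) := by
    rw [SimpleGraph.edgeSet_sup, SimpleGraph.edgeSet_deleteEdges,
      SimpleGraph.edgeSet_edge_of_ne hne, Set.union_singleton]
  have hcard : (H.deleteEdges {e} ⊔ SimpleGraph.edge x y).edgeSet.ncard = H.edgeSet.ncard := by
    rw [hset]
    rw [SimpleGraph.edgeSet_deleteEdges] at hnot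
    rw [Set.ncard_insert_of_notMem hnot, Set.ncard_sdiff_singleton_add_one he]
  have heq : (H.deleteEdges {e} ⊔ SimpleGraph.edge x y).edgeSet = F.edgeSet :=
    Set.eq_of_subset_of_ncard_le (SimpleGraph.edgeSet_mono hle) (by omega) (Set.toFinite _)
  rwa [SimpleGraph.edgeSet_injective heq]

/-- Symmetric exchange for spanning trees. -/
lemma SimpleGraph.IsTree.exists_symmetric_exchange {V : Type*} [Finite V] {H K : SimpleGraph V}
    (hH : H.IsTree) (hK : K.IsTree) (hne : H ≠ K) :
    ∃ e ∈ H.edgeSet \ K.edgeSet, ∃ f ∈ K.edgeSet \ H.edgeSet,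
      (H.deleteEdges {e} ⊔ SimpleGraph.fromEdgeSet {f}).IsTree ∧
      (K.deleteEdges {f} ⊔ SimpleGraph.fromEdgeSet {e}).IsTree := by
  have hle : ¬ H ≤ K := fun h =>
    hne (le_antisymm h ((SimpleGraph.isTree_iff_minimal_connected.1 hK).2 hH.connected h))
  obtain ⟨e, heH, heK⟩ := Set.not_subset.1 (mt SimpleGraph.edgeSet_subset_edgeSet.1 hle)
  induction e with | h x y =>
  have hbr : ¬ (H.deleteEdges {s(x, y)}).Reachable x y :=
    SimpleGraph.isAcyclic_iff_forall_isBridge.1 hH.isAcyclic heH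
  obtain ⟨p, hp⟩ := hK.connected.exists_isPath x y
  obtain ⟨d, hd, hd1, hd2⟩ := p.exists_boundary_dart
    {z | (H.deleteEdges {s(x, y)}).Reachable x z} (SimpleGraph.Reachable.refl x) hbr
  obtain ⟨⟨a, b⟩, hab⟩ := d
  have hnr : ¬ (H.deleteEdges {s(x, y)}).Reachable a b := fun h => hd2 (hd1.trans h)
  have hfp : s(a, b) ∈ p.edges := List.mem_map.2 ⟨_, hd, rfl⟩
  have hfH : s(a, b) ∉ H.edgeSet := fun h => hnr <| SimpleGraph.Adj.reachable <| by
    rw [SimpleGraph.deleteEdges_adj]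
    refine ⟨h, fun h' => heK ?_⟩
    rw [← Set.mem_singleton_iff.1 h']
    exact hab
  have hnrK : ¬ (K.deleteEdges {s(a, b)}).Reachable x y := by
    rw [SimpleGraph.reachable_deleteEdges_iff_exists_walk]
    rintro ⟨q, hq⟩
    have := congrArg Subtype.val
      ((hK.isAcyclic.subsingleton_path x y).elim ⟨p, hp⟩ q.toPath)
    simp only at this
    rw [this] at hfp
    exact hq (q.edges_toPath_subset_edges hfp)
  exact ⟨s(x, y), ⟨heH, heK⟩, s(a, b), ⟨hab, hfH⟩, hH.deleteEdges_sup_edge heH hnr,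
    hK.deleteEdges_sup_edge hab hnrK⟩

lemma isSpanningTreeEdges_edgeSet {V : Type*} {G H : SimpleGraph V} (hle : H ≤ G)
    (hH : H.IsTree) : IsSpanningTreeEdges G H.edgeSet :=
  ⟨SimpleGraph.edgeSet_mono hle, by rwa [SimpleGraph.fromEdgeSet_edgeSet]⟩

lemma IsSpanningTreeEdges.edgeSet_fromEdgeSet {V : Type*} {G : SimpleGraph V}
    {T : Set (Sym2 V)} (hT : IsSpanningTreeEdges G T) :
    (SimpleGraph.fromEdgeSet T).edgeSet = T := by
  rw [SimpleGraph.edgeSet_fromEdgeSet, sdiff_eq_left, Set.disjoint_left]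
  exact fun e he => G.not_isDiag_of_mem_edgeSet (hT.1 he)

/-- Symmetric exchange for edge sets of spanning trees. -/
lemma IsSpanningTreeEdges.exists_symmetric_exchange {V : Type*} [Finite V] {G : SimpleGraph V}
    {S T : Set (Sym2 V)} (hS : IsSpanningTreeEdges G S) (hT : IsSpanningTreeEdges G T)
    (hne : S ≠ T) :
    ∃ e ∈ S \ T, ∃ f ∈ T \ S, IsSpanningTreeEdges G (insert f (S \ {e})) ∧
      IsSpanningTreeEdges G (insert e (T \ {f})) := by
  have key : ∀ {S : Set (Sym2 V)} {e f : Sym2 V}, IsSpanningTreeEdges G S → f ∈ G.edgeSet →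
      ((SimpleGraph.fromEdgeSet S).deleteEdges {e} ⊔ SimpleGraph.fromEdgeSet {f}).IsTree →
      IsSpanningTreeEdges G (insert f (S \ {e})) := by
    intro S e f hS hf h
    refine ⟨Set.insert_subset hf (Set.sdiff_subset.trans hS.1), ?_⟩
    convert h using 1
    rw [SimpleGraph.deleteEdges, ← SimpleGraph.fromEdgeSet_sdiff, ← SimpleGraph.fromEdgeSet_union,
      Set.union_singleton]
  obtain ⟨e, he, f, hf, h1, h2⟩ := hS.2.exists_symmetric_exchange hT.2 fun h => hne <| by
    rw [← hS.edgeSet_fromEdgeSet, h, hT.edgeSet_fromEdgeSet]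
  rw [hS.edgeSet_fromEdgeSet, hT.edgeSet_fromEdgeSet] at he hf
  exact ⟨e, he, f, hf, key hS (hT.1 hf.1) h1, key hT (hS.1 he.1) h2⟩

lemma coIndicator_exchange {V : Type*} {G : SimpleGraph V} {S : Set (Sym2 V)} {e f : G.edgeSet}
    (he : (e : Sym2 V) ∈ S) (hf : (f : Sym2 V) ∉ S) :
    coIndicator G (insert (f : Sym2 V) (S \ {(e : Sym2 V)})) =
      coIndicator G S + (stdVec e - stdVec f) := by
  funext g
  have hef : e ≠ f := by
    rintro rfl
    exact hf he
  simp only [coIndicator, stdVec, Pi.add_apply, Pi.sub_apply, Set.mem_insert_iff, Set.mem_sdiff,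
    Set.mem_singleton_iff, Subtype.coe_inj]
  by_cases hge : g = e
  · subst hge
    simp [he, hef]
  · by_cases hgf : g = f
    · subst hgf
      simp [hf, hge]
    · simp [hge, hgf]

/-- The left endpoint of an extreme segment is an extreme point. -/
lemma IsExtreme.left_mem_extremePoints_of_segment {ι : Type*} {P : Set (ι → ℝ)} {u v : ι → ℝ}
    (h : IsExtreme ℝ P (segment ℝ u v)) : u ∈ P.extremePoints ℝ := by
  refine h.extremePoints_subset_extremePoints ?_
  rw [mem_extremePoints_iff_left]
  refine ⟨left_mem_segment ℝ u v, fun x hx y hy hu => ?_⟩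
  rw [segment_eq_image'] at hx hy
  obtain ⟨s, hs, rfl⟩ := hx
  obtain ⟨t, ht, rfl⟩ := hy
  obtain ⟨a, b, ha, hb, hab, hu⟩ := hu
  funext i
  have hi := congrFun hu i
  simp only [Pi.add_apply, Pi.smul_apply, Pi.sub_apply, smul_eq_mul] at hi ⊢
  have hzero : (a * s + b * t) * (v i - u i) = 0 := by
    obtain rfl : b = 1 - a := by linarith
    linarith
  rcases mul_eq_zero.1 hzero with h0 | h0
  · have h1 := mul_nonneg ha.le hs.1
    have h2 := mul_nonneg hb.le ht.1
    have h3 : a * s = 0 := by linarith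
    rcases mul_eq_zero.1 h3 with h4 | h4
    · exact absurd h4 ha.ne'
    · simp [h4]
  · simp [h0]

/-- If the endpoints of an extreme segment can be moved by opposite vectors inside the ambient
set, then the displacement is parallel to the segment. -/
lemma IsExtreme.exists_smul_of_add_mem_of_sub_mem {ι : Type*} {P : Set (ι → ℝ)} {u v w : ι → ℝ}
    (h : IsExtreme ℝ P (segment ℝ u v)) (hw : w ≠ 0) (hu : u + w ∈ P) (hv : v - w ∈ P) :
    ∃ c : ℝ, v - u = c • w := by
  have hmem : u + w ∈ segment ℝ u v := by
    refine h.left_mem_of_mem_openSegment hu hv (z := (1 / 2 : ℝ) • u + (1 / 2 : ℝ) • v)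
      ⟨1 / 2, 1 / 2, by norm_num, by norm_num, by norm_num, rfl⟩
      ⟨1 / 2, 1 / 2, by norm_num, by norm_num, by norm_num, ?_⟩
    module
  rw [segment_eq_image'] at hmem
  obtain ⟨t, -, ht⟩ := hmem
  have htw : t • (v - u) = w := add_left_cancel ht
  have ht0 : t ≠ 0 := by
    rintro rfl
    exact hw (by rw [← htw, zero_smul])
  exact ⟨t⁻¹, by rw [← htw, inv_smul_smul₀ ht0]⟩

/-- Every edge (one-dimensional extreme segment) of the Minkowski sum
`P_G = P_U + Δ̃_E` is parallel either to a standard basis vector `e_i` or to a difference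
`e_i − e_j` of standard basis vectors with `i ≠ j`. -/
theorem massive_symanzik_polytope_edges {V : Type*} [Fintype V] (G : SimpleGraph V)
    (hconn : G.Connected)
    (u v : G.edgeSet → ℝ) (huv : u ≠ v)
    (hedge : IsExtreme ℝ
      ((convexHull ℝ {x : G.edgeSet → ℝ | ∃ T, IsSpanningTreeEdges G T ∧ x = coIndicator G T}) +
        convexHull ℝ ({0} ∪ {x : G.edgeSet → ℝ | ∃ f : G.edgeSet, x = stdVec f}))
      (segment ℝ u v)) :
    (∃ (i : G.edgeSet) (c : ℝ), v - u = c • stdVec i) ∨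
      (∃ i j : G.edgeSet, i ≠ j ∧ ∃ c : ℝ, v - u = c • (stdVec i - stdVec j)) := by
  rw [← convexHull_add] at hedge
  have hu := extremePoints_convexHull_subset hedge.left_mem_extremePoints_of_segment
  have hv := extremePoints_convexHull_subset
    (segment_symm ℝ u v ▸ hedge).left_mem_extremePoints_of_segment
  obtain ⟨_, ⟨S, hS, rfl⟩, b, hb, rfl⟩ := hu
  obtain ⟨_, ⟨T, hT, rfl⟩, b', hb', rfl⟩ := hv
  by_cases hST : S = T
  · subst hST
    simp only [add_sub_add_left_eq_sub]
    rcases hb with rfl | ⟨f, rfl⟩ <;> rcases hb' with rfl | ⟨f', rfl⟩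
    · exact absurd rfl huv
    · exact Or.inl ⟨f', 1, by simp⟩
    · exact Or.inl ⟨f, -1, by simp⟩
    · refine Or.inr ⟨f', f, ?_, 1, by simp⟩
      rintro rfl
      exact huv rfl
  · obtain ⟨e, he, f, hf, h1, h2⟩ := hS.exists_symmetric_exchange hT hST
    lift e to G.edgeSet using hS.1 he.1
    lift f to G.edgeSet using hT.1 hf.1
    have hef : e ≠ f := by
      rintro rfl
      exact he.2 hf.1
    have hw : (stdVec e - stdVec f : G.edgeSet → ℝ) ≠ 0 := fun h => by
      simpa [stdVec, hef] using congrFun h e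
    refine Or.inr ⟨e, f, hef, hedge.exists_smul_of_add_mem_of_sub_mem hw
      (subset_convexHull ℝ _ ?_) (subset_convexHull ℝ _ ?_)⟩
    · rw [add_right_comm, ← coIndicator_exchange he.1 hf.2]
      exact Set.add_mem_add ⟨_, h1, rfl⟩ hb
    · rw [add_sub_right_comm, sub_eq_add_neg, neg_sub, ← coIndicator_exchange hf.1 he.2]
      exact Set.add_mem_add ⟨_, h2, rfl⟩ hb'
end
end

section
/- Let G be a finite connected simple graph with edge set E. Let A ⊆ ℤ^E be the set consisting of all vectors 1_{E∖T} and 1_{E∖T} + e_j, where T ranges over edge sets of spanning trees of G and j ranges over E, together with all vectors 1_{E∖F} where F ranges over edge sets of spanning two-forests of G. Then conv(A) = P_U + Δ̃_E, where P_U = conv{1_{E∖T} : T a spanning tree} and Δ̃_E = conv({0} ∪ {e_e : e ∈ E}); in particular conv(A) (the Newton polytope of the Lee–Pomeransky polynomial U + F of G when all internal masses are nonzero) has the integer decomposition property. -/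
open scoped Pointwise
open Classical

noncomputable section

/-- Frank's discrete sandwich theorem: an integral supermodular function below an integral
submodular function is separated from it by an integral modular function. -/
theorem exists_modular_between {α : Type*} [DecidableEq α] (s : Finset α) :
    ∀ p f : Finset α → ℤ,
      (∀ S ⊆ s, ∀ T ⊆ s, p S + p T ≤ p (S ∪ T) + p (S ∩ T)) →
      (∀ S ⊆ s, ∀ T ⊆ s, f (S ∪ T) + f (S ∩ T) ≤ f S + f T) →
      (∀ S ⊆ s, p S ≤ f S) → p ∅ = 0 → f ∅ = 0 →
      ∃ m : α → ℤ, ∀ S ⊆ s, p S ≤ ∑ i ∈ S, m i ∧ ∑ i ∈ S, m i ≤ f S := by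
  induction s using Finset.induction_on with
  | empty =>
    intro p f _ _ _ hp0 hf0
    refine ⟨0, fun S hS => ?_⟩
    obtain rfl := Finset.subset_empty.1 hS
    simp [hp0, hf0]
  | insert e s he ih =>
    intro p f hp hf hpf hp0 hf0
    have sub : ∀ {S}, S ⊆ s → S ⊆ insert e s := fun h => h.trans (Finset.subset_insert _ _)
    have sub' : ∀ {S}, S ⊆ s → insert e S ⊆ insert e s := fun h => Finset.insert_subset_insert _ h
    have hnot : ∀ {S}, S ⊆ s → e ∉ S := fun h h' => he (h h')
    obtain ⟨S₀, hS₀, hmax⟩ := Finset.exists_max_image s.powerset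
      (fun S => p (insert e S) - f S) ⟨∅, by simp⟩
    rw [Finset.mem_powerset] at hS₀
    obtain ⟨a, ha⟩ : ∃ a, a = p (insert e S₀) - f S₀ := ⟨_, rfl⟩
    have hlow : ∀ S ⊆ s, p (insert e S) - f S ≤ a := fun S hS => by
      rw [ha]
      exact hmax S (Finset.mem_powerset.2 hS)
    have hup : ∀ S ⊆ s, a ≤ f (insert e S) - p S := fun S hS => by
      have h1 := hp _ (sub' hS₀) _ (sub hS)
      have h2 := hf _ (sub hS₀) _ (sub' hS)
      rw [Finset.insert_union, Finset.insert_inter_of_notMem (hnot hS)] at h1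
      rw [Finset.union_insert, Finset.inter_insert_of_notMem (hnot hS₀)] at h2
      have h3 := hpf _ (sub' (Finset.union_subset hS₀ hS))
      have h4 := hpf _ (sub (Finset.inter_subset_left.trans hS₀ : S₀ ∩ S ⊆ s))
      linarith
    obtain ⟨m, hm⟩ := ih (fun S => max (p S) (p (insert e S) - a))
      (fun S => min (f S) (f (insert e S) - a))
      (by
        intro S hS T hT
        have h1 := hp _ (sub hS) _ (sub hT)
        have h2 := hp _ (sub' hS) _ (sub hT)
        have h3 := hp _ (sub hS) _ (sub' hT)
        have h4 := hp _ (sub' hS) _ (sub' hT)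
        rw [Finset.insert_union, Finset.insert_inter_of_notMem (hnot hT)] at h2
        rw [Finset.union_insert, Finset.inter_insert_of_notMem (hnot hS)] at h3
        rw [← Finset.insert_union_distrib, ← Finset.insert_inter_distrib] at h4
        grind)
      (by
        intro S hS T hT
        have h1 := hf _ (sub hS) _ (sub hT)
        have h2 := hf _ (sub' hS) _ (sub hT)
        have h3 := hf _ (sub hS) _ (sub' hT)
        have h4 := hf _ (sub' hS) _ (sub' hT)
        rw [Finset.insert_union, Finset.insert_inter_of_notMem (hnot hT)] at h2
        rw [Finset.union_insert, Finset.inter_insert_of_notMem (hnot hS)] at h3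
        rw [← Finset.insert_union_distrib, ← Finset.insert_inter_distrib] at h4
        grind)
      (by
        intro S hS
        have h1 := hlow S hS
        have h2 := hup S hS
        have h3 := hpf _ (sub hS)
        have h4 := hpf _ (sub' hS)
        grind)
      (by
        have h1 := hlow ∅ (Finset.empty_subset _)
        grind)
      (by
        have h1 := hup ∅ (Finset.empty_subset _)
        grind)
    refine ⟨Function.update m e a, fun S hS => ?_⟩
    by_cases heS : e ∈ S
    · have hT : S.erase e ⊆ s := by
        rw [← Finset.erase_insert he]
        exact Finset.erase_subset_erase _ hS
      obtain ⟨h1, h2⟩ := hm _ hT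
      have h3 : ∑ i ∈ S, Function.update m e a i = a + ∑ i ∈ S.erase e, m i := by
        rw [← Finset.add_sum_erase _ _ heS, Function.update_self,
          Finset.sum_update_of_notMem (Finset.notMem_erase _ _)]
      simp only [Finset.insert_erase heS, max_le_iff, le_min_iff] at h1 h2
      constructor <;> linarith
    · have hT : S ⊆ s := by
        rwa [Finset.subset_insert_iff_of_notMem heS] at hS
      rw [Finset.sum_update_of_notMem heS]
      exact ⟨(le_max_left _ _).trans (hm S hT).1, (hm S hT).2.trans (min_le_left _ _)⟩

/-- A set function is normalized submodular if it vanishes at `∅` and is submodular. -/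
structure IsNormSubmodular {α : Type*} [DecidableEq α] (f : Finset α → ℤ) : Prop where
  empty : f ∅ = 0
  submodular : ∀ S T, f (S ∪ T) + f (S ∩ T) ≤ f S + f T

theorem IsNormSubmodular.add {α : Type*} [DecidableEq α] {f g : Finset α → ℤ}
    (hf : IsNormSubmodular f) (hg : IsNormSubmodular g) : IsNormSubmodular (f + g) where
  empty := by simp [hf.empty, hg.empty]
  submodular S T := by
    have h1 := hf.submodular S T
    have h2 := hg.submodular S T
    simp only [Pi.add_apply]
    linarith

theorem IsNormSubmodular.nsmul {α : Type*} [DecidableEq α] {f : Finset α → ℤ}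
    (hf : IsNormSubmodular f) (k : ℕ) : IsNormSubmodular (k • f) := by
  induction k with
  | zero => exact ⟨by simp, by simp⟩
  | succ k ih => rw [succ_nsmul]; exact ih.add hf

/-- `x` is an integer point of the base polytope of the set function `f`. -/
def IsIntBase {α : Type*} [Fintype α] (f : Finset α → ℤ) (x : α → ℤ) : Prop :=
  (∀ S, ∑ i ∈ S, x i ≤ f S) ∧ ∑ i, x i = f Finset.univ

theorem IsIntBase.add {α : Type*} [Fintype α] {f g : Finset α → ℤ} {x y : α → ℤ}
    (hx : IsIntBase f x) (hy : IsIntBase g y) : IsIntBase (f + g) (x + y) := by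
  refine ⟨fun S => ?_, ?_⟩
  · simpa [Finset.sum_add_distrib] using add_le_add (hx.1 S) (hy.1 S)
  · simp [Finset.sum_add_distrib, hx.2, hy.2]

/-- Integer points of the base polytope of `f + g` are sums of integer points of the base
polytopes of `f` and `g`. -/
theorem IsIntBase.exists_add {α : Type*} [Fintype α] [DecidableEq α] {f g : Finset α → ℤ}
    (hf : IsNormSubmodular f) (hg : IsNormSubmodular g) {x : α → ℤ} (hx : IsIntBase (f + g) x) :
    ∃ y z, x = y + z ∧ IsIntBase f y ∧ IsIntBase g z := by
  obtain ⟨m, hm⟩ := exists_modular_between Finset.univ (fun S => ∑ i ∈ S, x i - g S) f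
    (fun S _ T _ => by
      have h1 := hg.submodular S T
      have h2 := Finset.sum_union_inter (s₁ := S) (s₂ := T) (f := x)
      linarith)
    (fun S _ T _ => hf.submodular S T)
    (fun S _ => by have := hx.1 S; simp only [Pi.add_apply] at this; linarith)
    (by simp [hg.empty]) hf.empty
  have h1 := hm Finset.univ subset_rfl
  have h2 := hx.2
  simp only [Pi.add_apply] at h2
  refine ⟨m, x - m, by simp, ⟨fun S => (hm S (Finset.subset_univ _)).2, by linarith⟩,
    fun S => ?_, ?_⟩
  · have := (hm S (Finset.subset_univ _)).1
    simp only [Pi.sub_apply, Finset.sum_sub_distrib]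
    linarith
  · simp only [Pi.sub_apply, Finset.sum_sub_distrib]
    linarith

/-- The set of integer points of the base polytope of `f`, seen as real vectors. -/
def intBaseSet {α : Type*} [Fintype α] (f : Finset α → ℤ) : Set (α → ℝ) :=
  (fun (x : α → ℤ) i => (x i : ℝ)) '' {x | IsIntBase f x}

theorem mem_smul_convexHull_intBaseSet {α : Type*} [Fintype α] [DecidableEq α]
    {f : Finset α → ℤ} (hf : IsNormSubmodular f) (hne : (intBaseSet f).Nonempty) (k : ℕ)
    {x : α → ℤ} (hx : IsIntBase (k • f) x) :
    (fun i => (x i : ℝ)) ∈ (k : ℝ) • convexHull ℝ (intBaseSet f) := by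
  induction k generalizing x with
  | zero =>
    have hle : ∀ i, x i ≤ 0 := fun i => by simpa using hx.1 {i}
    have h0 : ∑ i, x i = 0 := by simpa using hx.2
    have hx0 := (Finset.sum_eq_zero_iff_of_nonpos fun i _ => hle i).1 h0
    obtain ⟨a, ha⟩ := hne
    refine ⟨a, subset_convexHull _ _ ha, ?_⟩
    ext i
    simp [hx0 i (Finset.mem_univ i)]
  | succ k ih =>
    rw [succ_nsmul] at hx
    obtain ⟨y, z, rfl, hy, hz⟩ := hx.exists_add (hf.nsmul k) hf
    rw [Nat.cast_succ, (convex_convexHull ℝ _).add_smul (Nat.cast_nonneg _) zero_le_one, one_smul]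
    refine ⟨_, ih hy, _, subset_convexHull _ _ ⟨z, hz, rfl⟩, ?_⟩
    ext i
    simp

theorem sum_of_mem_convexHull_intBaseSet {α : Type*} [Fintype α] {f : Finset α → ℤ}
    {a : α → ℝ} (ha : a ∈ convexHull ℝ (intBaseSet f)) :
    (∀ S, ∑ i ∈ S, a i ≤ f S) ∧ ∑ i, a i = f Finset.univ := by
  have hlin : ∀ S : Finset α, IsLinearMap ℝ fun a : α → ℝ => ∑ i ∈ S, a i := fun S =>
    ⟨fun x y => by simp [Finset.sum_add_distrib], fun c x => by simp [Finset.mul_sum]⟩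
  constructor
  · intro S
    refine convexHull_min (t := {a : α → ℝ | ∑ i ∈ S, a i ≤ f S}) ?_
      (convex_halfSpace_le (hlin S) _) ha
    rintro _ ⟨x, hx, rfl⟩
    have := hx.1 S
    change ∑ i ∈ S, (x i : ℝ) ≤ f S
    exact_mod_cast this
  · refine convexHull_min (t := {a : α → ℝ | ∑ i, a i = f Finset.univ}) ?_
      (convex_hyperplane (hlin Finset.univ) _) ha
    rintro _ ⟨x, hx, rfl⟩
    have := hx.2
    change ∑ i, (x i : ℝ) = f Finset.univ
    exact_mod_cast this

/-- Forgetting one coordinate of an integral base polytope gives a polytope with the integer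
decomposition property. -/
theorem hasIDP_image_convexHull_intBaseSet {ι : Type*} [Fintype ι] [DecidableEq ι]
    {f : Finset (Option ι) → ℤ} (hf : IsNormSubmodular f) :
    HasIDP (LinearMap.funLeft ℝ ℝ (some : ι → Option ι) '' convexHull ℝ (intBaseSet f)) := by
  set P := convexHull ℝ (intBaseSet f)
  set π := LinearMap.funLeft ℝ ℝ (some : ι → Option ι) with hπ
  intro k hk
  obtain ⟨k, rfl⟩ : ∃ l, k = l + 1 := ⟨k - 1, by omega⟩
  rw [Nat.add_sub_cancel]
  have hconv : Convex ℝ (π '' P) := (convex_convexHull ℝ _).linear_image π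
  have hadd : ((k + 1 : ℕ) : ℝ) • (π '' P) = (k : ℝ) • (π '' P) + π '' P := by
    rw [Nat.cast_succ, hconv.add_smul (Nat.cast_nonneg _) zero_le_one, one_smul]
  apply Set.Subset.antisymm
  · rintro x ⟨⟨_, ⟨a, ha, rfl⟩, hax⟩, hx⟩
    choose n hn using hx
    have hne : (intBaseSet f).Nonempty := convexHull_nonempty_iff.1 ⟨a, ha⟩
    obtain ⟨h1, h2⟩ := sum_of_mem_convexHull_intBaseSet ha
    obtain ⟨z, hz⟩ : ∃ z : Option ι → ℤ, ∀ i, (z i : ℝ) = ((k + 1 : ℕ) : ℝ) * a i := by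
      refine ⟨fun i => i.elim ((k + 1 : ℕ) * f Finset.univ - ∑ i, n i) n, ?_⟩
      have hsome : ∀ i, (n i : ℝ) = ((k + 1 : ℕ) : ℝ) * a (some i) := fun i => by
        rw [← hn i, ← hax]
        rfl
      rintro (_ | i)
      · rw [Fintype.sum_option] at h2
        have : (∑ i, (n i : ℝ)) = ((k + 1 : ℕ) : ℝ) * ∑ i, a (some i) := by
          rw [Finset.mul_sum]
          exact Finset.sum_congr rfl fun i _ => hsome i
        simp only [Option.elim]
        push_cast at this ⊢
        rw [this, ← h2]
        ring
      · exact hsome i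
    have hz' : ∀ S, ((∑ i ∈ S, z i : ℤ) : ℝ) = ((k + 1 : ℕ) : ℝ) * ∑ i ∈ S, a i := fun S => by
      rw [Finset.mul_sum, Int.cast_sum]
      exact Finset.sum_congr rfl fun i _ => hz i
    have hbase : IsIntBase ((k + 1) • f) z := by
      constructor
      · intro S
        have : ((∑ i ∈ S, z i : ℤ) : ℝ) ≤ (((k + 1 : ℕ) * f S : ℤ) : ℝ) := by
          rw [hz', Int.cast_mul, Int.cast_natCast]
          exact mul_le_mul_of_nonneg_left (h1 S) (Nat.cast_nonneg _)
        simpa using Int.cast_le.1 this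
      · have : ((∑ i, z i : ℤ) : ℝ) = (((k + 1 : ℕ) * f Finset.univ : ℤ) : ℝ) := by
          rw [hz', Int.cast_mul, Int.cast_natCast, h2]
        simpa using Int.cast_injective this
    rw [succ_nsmul] at hbase
    obtain ⟨y, w, rfl, hy, hw⟩ := hbase.exists_add (hf.nsmul k) hf
    refine ⟨fun i => (y (some i) : ℝ), ⟨?_, fun i => ⟨_, rfl⟩⟩,
      fun i => (w (some i) : ℝ), ⟨?_, fun i => ⟨_, rfl⟩⟩, ?_⟩
    · obtain ⟨b, hb, hby⟩ := mem_smul_convexHull_intBaseSet hf hne k hy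
      refine ⟨π b, ⟨b, hb, rfl⟩, ?_⟩
      ext i
      exact congrFun hby (some i)
    · exact ⟨_, subset_convexHull _ _ ⟨w, hw, rfl⟩, rfl⟩
    · ext i
      have := hz (some i)
      rw [← hax]
      simpa [hπ] using this
  · rintro _ ⟨y, ⟨hy, hyl⟩, w, ⟨hw, hwl⟩, rfl⟩
    refine ⟨hadd ▸ Set.add_mem_add hy hw, fun i => ?_⟩
    obtain ⟨a, ha⟩ := hyl i
    obtain ⟨b, hb⟩ := hwl i
    exact ⟨a + b, by simp [ha, hb]⟩

/-- The rank function of the matroid dual to the one represented by `v`. -/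
def dualRank (K : Type*) {ι M : Type*} [Fintype ι] [Field K] [AddCommGroup M] [Module K M]
    (v : ι → M) (S : Finset ι) : ℤ :=
  S.card + (v '' (↑S)ᶜ).finrank K - (Set.range v).finrank K

section DualRank

variable {K ι M : Type*} [Field K] [AddCommGroup M] [Module K M] (v : ι → M)

theorem finrank_image_le_card (S : Finset ι) : (v '' S).finrank K ≤ S.card := by
  classical
  rw [← Finset.coe_image]
  exact (finrank_span_finset_le_card _).trans Finset.card_image_le

theorem finrank_image_union_add_inter_le [Module.Finite K M] (X Y : Set ι) :
    (v '' (X ∪ Y)).finrank K + (v '' (X ∩ Y)).finrank K ≤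
      (v '' X).finrank K + (v '' Y).finrank K := by
  have h1 := Submodule.finrank_sup_add_finrank_inf_eq
    (Submodule.span K (v '' X)) (Submodule.span K (v '' Y))
  rw [← Submodule.span_union, ← Set.image_union] at h1
  have h2 : Submodule.span K (v '' (X ∩ Y)) ≤
      Submodule.span K (v '' X) ⊓ Submodule.span K (v '' Y) :=
    le_inf (Submodule.span_mono (Set.image_mono Set.inter_subset_left))
      (Submodule.span_mono (Set.image_mono Set.inter_subset_right))
  have h3 := Submodule.finrank_mono h2
  unfold Set.finrank
  omega

theorem finrank_image_mono [Module.Finite K M] {X Y : Set ι} (h : X ⊆ Y) :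
    (v '' X).finrank K ≤ (v '' Y).finrank K :=
  Submodule.finrank_mono (Submodule.span_mono (Set.image_mono h))

variable [Fintype ι]

theorem dualRank_univ : dualRank K v Finset.univ = Fintype.card ι - (Set.range v).finrank K := by
  have h : v '' (↑(Finset.univ : Finset ι))ᶜ = ∅ := by simp
  rw [dualRank, h, Set.finrank_empty]
  simp

variable [DecidableEq ι]

theorem isNormSubmodular_dualRank [Module.Finite K M] : IsNormSubmodular (dualRank K v) where
  empty := by simp [dualRank]
  submodular S T := by
    have h1 := finrank_image_union_add_inter_le (K := K) v (↑S)ᶜ (↑T)ᶜ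
    have h2 := Finset.card_union_add_card_inter S T
    rw [← Set.compl_inter, ← Set.compl_union] at h1
    unfold dualRank
    push_cast
    omega

/-- The integer points of the base polytope of the dual matroid are the indicator vectors of the
complements of bases. -/
theorem isIntBase_dualRank_iff [Module.Finite K M] {b : ι → ℤ} :
    IsIntBase (dualRank K v) b ↔ ∃ T : Finset ι, (b = fun i => if i ∈ T then 0 else 1) ∧
      (v '' T).finrank K = (Set.range v).finrank K ∧ T.card = (Set.range v).finrank K := by
  constructor
  · rintro ⟨hle, heq⟩
    have hrange : ∀ X : Set ι, (v '' X).finrank K ≤ (Set.range v).finrank K := fun X => by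
      rw [← Set.image_univ]
      exact finrank_image_mono v (Set.subset_univ _)
    have hone : ∀ i, b i ≤ 1 := fun i => by
      have h1 := hle {i}
      have h2 := hrange (↑({i} : Finset ι))ᶜ
      simp only [dualRank, Finset.sum_singleton, Finset.card_singleton] at h1
      push_cast at h1 h2
      omega
    have hnonneg : ∀ i, 0 ≤ b i := fun i => by
      have h1 := hle {i}ᶜ
      have h2 := finrank_image_le_card (K := K) v {i}
      have h3 := Finset.sum_compl_add_sum {i} b
      have h4 := Finset.card_compl_add_card ({i} : Finset ι)
      rw [dualRank_univ] at heq
      simp only [dualRank, Finset.coe_compl, compl_compl] at h1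
      simp only [Finset.sum_singleton, Finset.card_singleton] at h2 h3 h4
      omega
    have hb : b = fun i => if i ∈ ({i | b i = 0} : Finset ι) then 0 else 1 := by
      ext i
      have h1 := hone i
      have h2 := hnonneg i
      simp only [Finset.mem_filter_univ]
      split_ifs with h <;> omega
    generalize ({i | b i = 0} : Finset ι) = T at hb
    have hsum : ∀ S : Finset ι, ∑ i ∈ S, b i = (S \ T).card := fun S => by
      rw [hb, Finset.card_eq_sum_ones, Finset.sdiff_eq_filter, Finset.sum_filter]
      push_cast
      exact Finset.sum_congr rfl fun i _ => by split_ifs <;> rfl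
    have h1 := hle Tᶜ
    have h2 := hrange T
    have h3 := Finset.card_compl_add_card T
    rw [hsum, dualRank_univ, ← Finset.compl_eq_univ_sdiff] at heq
    rw [hsum, Finset.sdiff_eq_self_of_disjoint disjoint_compl_left] at h1
    simp only [dualRank, Finset.coe_compl, compl_compl] at h1
    exact ⟨T, hb, by omega, by omega⟩
  · rintro ⟨T, rfl, hspan, hcard⟩
    have hsum : ∀ S : Finset ι, (∑ i ∈ S, if i ∈ T then (0 : ℤ) else 1) = (S \ T).card :=
      fun S => by
        rw [Finset.card_eq_sum_ones, Finset.sdiff_eq_filter, Finset.sum_filter]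
        push_cast
        exact Finset.sum_congr rfl fun i _ => by split_ifs <;> rfl
    refine ⟨fun S => ?_, ?_⟩
    · have h1 := finrank_image_union_add_inter_le (K := K) v (↑S)ᶜ ↑(S ∩ T)
      have h2 := finrank_image_le_card (K := K) v (S ∩ T)
      have h3 : (v '' T).finrank K ≤ (v '' ((↑S)ᶜ ∪ ↑(S ∩ T))).finrank K :=
        finrank_image_mono v fun i hi => by
          by_cases h : i ∈ S <;> simp_all
      have h4 := Finset.card_sdiff_add_card_inter S T
      rw [hsum, dualRank]
      omega
    · have h3 := Finset.card_compl_add_card T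
      rw [hsum, dualRank_univ, ← Finset.compl_eq_univ_sdiff]
      omega

end DualRank

theorem isNormSubmodular_eraseNone {ι : Type*} [DecidableEq ι] {f : Finset ι → ℤ}
    (hf : IsNormSubmodular f) : IsNormSubmodular fun S : Finset (Option ι) => f S.eraseNone where
  empty := by simp [hf.empty]
  submodular S T := by
    rw [Finset.eraseNone_union, Finset.eraseNone_inter]
    exact hf.submodular _ _

theorem isIntBase_eraseNone_iff {ι : Type*} [Fintype ι] [DecidableEq ι] {f : Finset ι → ℤ}
    (hf : IsNormSubmodular f) {x : Option ι → ℤ} :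
    IsIntBase (fun S => f S.eraseNone) x ↔ ∃ b, IsIntBase f b ∧ x = fun i => Option.elim' 0 b i := by
  have huniv : (Finset.univ : Finset (Option ι)).eraseNone = Finset.univ := by
    ext
    simp
  constructor
  · rintro ⟨hle, heq⟩
    have hmap : ∀ S : Finset ι, ∑ i ∈ S, x (some i) ≤ f S := fun S => by
      simpa using hle (S.map Function.Embedding.some)
    have h0 : x none ≤ 0 := by simpa [hf.empty] using hle {none}
    simp only [Fintype.sum_option, huniv] at heq
    have h1 := hmap Finset.univ
    refine ⟨fun i => x (some i), ⟨hmap, by linarith⟩, ?_⟩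
    ext (_ | i)
    · simp only [Option.elim']
      linarith
    · rfl
  · rintro ⟨b, ⟨hle, heq⟩, rfl⟩
    refine ⟨fun S => ?_, ?_⟩
    · rw [← Finset.sum_eraseNone]
      exact hle _
    · simp only [← Finset.sum_eraseNone, huniv, heq]

/-- The rank function of the uniform matroid of rank one. -/
def unifRankOne {α : Type*} [DecidableEq α] (S : Finset α) : ℤ := if S = ∅ then 0 else 1

theorem isNormSubmodular_unifRankOne {α : Type*} [DecidableEq α] :
    IsNormSubmodular (unifRankOne (α := α)) where
  empty := by simp [unifRankOne]
  submodular S T := by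
    unfold unifRankOne
    rcases S.eq_empty_or_nonempty with rfl | hS
    · simp
    rcases T.eq_empty_or_nonempty with rfl | hT
    · simp
    simp only [Finset.union_eq_empty, hS.ne_empty, hT.ne_empty]
    split_ifs <;> simp_all

theorem isIntBase_unifRankOne_iff {α : Type*} [Fintype α] [DecidableEq α] [Nonempty α]
    {c : α → ℤ} : IsIntBase unifRankOne c ↔ ∃ j, c = Pi.single j 1 := by
  have huniv : unifRankOne (Finset.univ : Finset α) = 1 := by
    simp [unifRankOne, Finset.univ_nonempty.ne_empty]
  constructor
  · rintro ⟨hle, heq⟩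
    rw [huniv] at heq
    have hle1 : ∀ S, ∑ i ∈ S, c i ≤ 1 := fun S => (hle S).trans (by
      unfold unifRankOne
      split_ifs <;> simp)
    have hnonneg : ∀ i, 0 ≤ c i := fun i => by
      have h1 := hle1 {i}ᶜ
      have h2 := Finset.sum_compl_add_sum {i} c
      rw [Finset.sum_singleton] at h2
      omega
    obtain ⟨j, hj⟩ : ∃ j, c j ≠ 0 := by
      by_contra! h
      simp [h] at heq
    have hj1 : c j = 1 := by
      have h1 := hle1 {j}
      have h2 := hnonneg j
      rw [Finset.sum_singleton] at h1
      omega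
    refine ⟨j, funext fun i => ?_⟩
    rcases eq_or_ne i j with rfl | hij
    · simpa using hj1
    · have h1 := hle1 {i, j}
      have h2 := hnonneg i
      rw [Finset.sum_pair hij] at h1
      rw [Pi.single_eq_of_ne hij]
      omega
  · rintro ⟨j, rfl⟩
    refine ⟨fun S => ?_, by simp [huniv]⟩
    rw [Finset.sum_pi_single']
    unfold unifRankOne
    split_ifs <;> simp_all

/-- The incidence vector of an edge over the field with two elements. -/
def edgeVec {V : Type*} (e : Sym2 V) : V → ZMod 2 := fun v => if v ∈ e then 1 else 0

theorem edgeVec_mk {V : Type*} {u v : V} (h : u ≠ v) :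
    edgeVec s(u, v) = Pi.single u 1 + Pi.single v 1 := by
  ext w
  simp only [edgeVec, Sym2.mem_iff, Pi.add_apply, Pi.single_apply]
  by_cases hu : w = u
  · subst hu
    simp [h]
  · simp [hu]

/-- The span of the incidence vectors of all pairs of vertices. -/
def pairSpan (V : Type*) : Submodule (ZMod 2) (V → ZMod 2) :=
  Submodule.span _ (Set.range fun p : V × V => Pi.single p.1 1 + Pi.single p.2 1)

theorem single_add_single_mem_pairSpan {V : Type*} (u v : V) :
    Pi.single u 1 + Pi.single v 1 ∈ pairSpan V :=
  Submodule.subset_span ⟨(u, v), rfl⟩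

theorem single_add_single_mem_span_of_reachable {V : Type*} {X : Set (Sym2 V)} {u v : V}
    (h : (SimpleGraph.fromEdgeSet X).Reachable u v) :
    Pi.single u 1 + Pi.single v 1 ∈ Submodule.span (ZMod 2) (edgeVec '' X) := by
  obtain ⟨p⟩ := h
  induction p with
  | nil =>
    rw [← two_smul (ZMod 2), show (2 : ZMod 2) = 0 from rfl, zero_smul]
    exact Submodule.zero_mem _
  | @cons a b c hab _ ih =>
    have h1 : Pi.single a 1 + Pi.single b 1 ∈ Submodule.span (ZMod 2) (edgeVec '' X) :=
      Submodule.subset_span ⟨s(a, b), hab.1, edgeVec_mk hab.2⟩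
    convert! Submodule.add_mem _ h1 ih using 1
    rw [add_assoc, ← add_assoc (Pi.single b 1), ← two_smul (ZMod 2) (Pi.single b 1),
      show (2 : ZMod 2) = 0 from rfl, zero_smul, zero_add]

theorem reachable_of_mem_span {V : Type*} [Fintype V] {X : Set (Sym2 V)} {u v : V}
    (h : Pi.single u 1 + Pi.single v 1 ∈ Submodule.span (ZMod 2) (edgeVec '' X))
    (hX : ∀ e ∈ X, ¬ e.IsDiag) : (SimpleGraph.fromEdgeSet X).Reachable u v := by
  by_contra hnot
  let c : V → ZMod 2 := fun w => if (SimpleGraph.fromEdgeSet X).Reachable u w then 1 else 0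
  let φ : (V → ZMod 2) →ₗ[ZMod 2] ZMod 2 := ∑ w, c w • LinearMap.proj w
  have hφ : ∀ a, φ (Pi.single a 1) = c a := fun a => by
    simp [φ, LinearMap.sum_apply, Pi.single_apply]
  have hker : Submodule.span (ZMod 2) (edgeVec '' X) ≤ LinearMap.ker φ := by
    rw [Submodule.span_le]
    rintro _ ⟨e, he, rfl⟩
    induction e with
    | _ a b =>
      have hab : a ≠ b := hX _ he
      have hadj : (SimpleGraph.fromEdgeSet X).Adj a b := ⟨he, hab⟩
      have hc : c a = c b := by
        have : (SimpleGraph.fromEdgeSet X).Reachable u a ↔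
            (SimpleGraph.fromEdgeSet X).Reachable u b :=
          ⟨fun h => h.trans hadj.reachable, fun h => h.trans hadj.reachable.symm⟩
        simp only [c, this]
      rw [edgeVec_mk hab, SetLike.mem_coe, LinearMap.mem_ker, map_add, hφ, hφ, hc,
        ← two_mul, show (2 : ZMod 2) = 0 from rfl, zero_mul]
  have := hker h
  rw [LinearMap.mem_ker, map_add, hφ, hφ] at this
  simp [c, hnot] at this

theorem span_edgeVec_eq_pairSpan_iff {V : Type*} [Fintype V] [Nonempty V] {X : Set (Sym2 V)}
    (hX : ∀ e ∈ X, ¬ e.IsDiag) :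
    Submodule.span (ZMod 2) (edgeVec '' X) = pairSpan V ↔
      (SimpleGraph.fromEdgeSet X).Connected := by
  constructor
  · intro h
    refine ⟨fun u v => reachable_of_mem_span ?_ hX⟩
    rw [h]
    exact single_add_single_mem_pairSpan u v
  · intro h
    apply le_antisymm
    · rw [Submodule.span_le]
      rintro _ ⟨e, he, rfl⟩
      induction e with
      | _ a b =>
        rw [edgeVec_mk (hX _ he)]
        exact single_add_single_mem_pairSpan a b
    · refine Submodule.span_le.2 ?_
      rintro _ ⟨⟨u, v⟩, rfl⟩
      exact single_add_single_mem_span_of_reachable (h.preconnected u v)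

theorem card_edgeSet_fromEdgeSet {V : Type*} {X : Set (Sym2 V)} (hX : ∀ e ∈ X, ¬ e.IsDiag) :
    Nat.card (SimpleGraph.fromEdgeSet X).edgeSet = X.ncard := by
  rw [SimpleGraph.edgeSet_fromEdgeSet, Nat.card_coe_set_eq]
  congr 1
  ext e
  simpa using hX e

theorem finrank_pairSpan_add_one (V : Type*) [Fintype V] [Nonempty V] :
    Module.finrank (ZMod 2) (pairSpan V) + 1 = Fintype.card V := by
  apply le_antisymm
  · obtain ⟨T, -, hT⟩ := (SimpleGraph.connected_top (V := V)).exists_isTree_le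
    have hdiag : ∀ e ∈ T.edgeSet, ¬ e.IsDiag := fun e he => T.not_isDiag_of_mem_edgeSet he
    have hconn := hT.connected
    rw [← SimpleGraph.fromEdgeSet_edgeSet T] at hconn
    rw [← (span_edgeVec_eq_pairSpan_iff hdiag).2 hconn, ← hT.card_edgeFinset,
      ← T.coe_edgeFinset, add_le_add_iff_right]
    exact finrank_image_le_card _ _
  · obtain ⟨v₀⟩ := ‹Nonempty V›
    have htop : pairSpan V ⊔ Submodule.span (ZMod 2) {Pi.single v₀ 1} = ⊤ := by
      rw [eq_top_iff, ← (Pi.basisFun (ZMod 2) V).span_eq, Submodule.span_le]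
      rintro _ ⟨v, rfl⟩
      rw [Pi.basisFun_apply, SetLike.mem_coe]
      have h1 := Submodule.add_mem_sup (single_add_single_mem_pairSpan v v₀)
        (Submodule.mem_span_singleton_self (R := ZMod 2) (Pi.single v₀ (1 : ZMod 2)))
      rwa [add_assoc, ← two_smul (ZMod 2) (Pi.single v₀ _), show (2 : ZMod 2) = 0 from rfl,
        zero_smul, add_zero] at h1
    have h1 := Submodule.finrank_add_le_finrank_add_finrank (pairSpan V)
      (Submodule.span (ZMod 2) {Pi.single v₀ 1})
    rw [htop, finrank_top, Module.finrank_fintype_fun_eq_card] at h1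
    have h2 : Module.finrank (ZMod 2)
        (Submodule.span (ZMod 2) {(Pi.single v₀ 1 : V → ZMod 2)}) ≤ 1 :=
      (finrank_span_le_card _).trans (by simp)
    omega

/-- Spanning trees are the bases of the matroid represented by the incidence vectors. -/
theorem isSpanningTreeEdges_image_iff {V : Type*} [Fintype V] {G : SimpleGraph V}
    (hconn : G.Connected) (T : Finset G.edgeSet) :
    IsSpanningTreeEdges G (Subtype.val '' (T : Set G.edgeSet)) ↔
      ((fun e : G.edgeSet => edgeVec e.1) '' T).finrank (ZMod 2) =
          (Set.range fun e : G.edgeSet => edgeVec e.1).finrank (ZMod 2) ∧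
        T.card = (Set.range fun e : G.edgeSet => edgeVec e.1).finrank (ZMod 2) := by
  have := hconn.nonempty
  have hdiag : ∀ e ∈ G.edgeSet, ¬ e.IsDiag := fun e he => G.not_isDiag_of_mem_edgeSet he
  have hsub : Subtype.val '' (T : Set G.edgeSet) ⊆ G.edgeSet := by
    rintro _ ⟨e, -, rfl⟩
    exact e.2
  have hrange : Submodule.span (ZMod 2) (Set.range fun e : G.edgeSet => edgeVec e.1) =
      pairSpan V := by
    have h : (Set.range fun e : G.edgeSet => edgeVec e.1) = edgeVec '' G.edgeSet := by
      rw [Set.image_eq_range]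
    rw [h, span_edgeVec_eq_pairSpan_iff hdiag, SimpleGraph.fromEdgeSet_edgeSet]
    exact hconn
  have hcard := finrank_pairSpan_add_one V
  have himage : (fun e : G.edgeSet => edgeVec e.1) '' T =
      edgeVec '' (Subtype.val '' (T : Set G.edgeSet)) :=
    (Set.image_image edgeVec Subtype.val (T : Set G.edgeSet)).symm
  have hfin : (Set.range fun e : G.edgeSet => edgeVec e.1).finrank (ZMod 2) =
      Module.finrank (ZMod 2) (pairSpan V) := by
    rw [Set.finrank, hrange]
  have hspan : ((fun e : G.edgeSet => edgeVec e.1) '' T).finrank (ZMod 2) =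
      Module.finrank (ZMod 2) (pairSpan V) ↔
      Submodule.span (ZMod 2) (edgeVec '' (Subtype.val '' (T : Set G.edgeSet))) = pairSpan V := by
    rw [Set.finrank, himage]
    refine ⟨fun h => Submodule.eq_of_le_of_finrank_eq ?_ h, fun h => by rw [h]⟩
    rw [← hrange, ← himage]
    exact Submodule.span_mono (Set.image_subset_range _ _)
  rw [hfin, hspan, span_edgeVec_eq_pairSpan_iff fun e he => hdiag e (hsub he)]
  unfold IsSpanningTreeEdges
  rw [SimpleGraph.isTree_iff_connected_and_card,
    card_edgeSet_fromEdgeSet fun e he => hdiag e (hsub he),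
    Set.ncard_image_of_injective _ Subtype.val_injective, Set.ncard_coe_finset,
    Nat.card_eq_fintype_card, ← hcard, add_left_inj]
  simp only [hsub, true_and]

/-- The vectors of the cobases of `G` are the integer points of the base polytope of the dual
graphic matroid. -/
theorem exists_isSpanningTreeEdges_iff {V : Type*} [Fintype V] {G : SimpleGraph V}
    (hconn : G.Connected) {x : G.edgeSet → ℝ} :
    (∃ T, IsSpanningTreeEdges G T ∧ x = coIndicator G T) ↔
      ∃ b, IsIntBase (dualRank (ZMod 2) fun e : G.edgeSet => edgeVec e.1) b ∧
        x = fun e => (b e : ℝ) := by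
  constructor
  · rintro ⟨T, hT, rfl⟩
    have himage : Subtype.val '' ((({e | e.1 ∈ T} : Finset G.edgeSet)) : Set G.edgeSet) = T := by
      ext e
      simp only [Finset.coe_filter_univ, Set.mem_image, Set.mem_ofPred_eq, Subtype.exists,
        exists_and_left, exists_prop, exists_eq_right_right]
      exact ⟨fun h => h.1, fun h => ⟨h, hT.1 h⟩⟩
    rw [← himage, isSpanningTreeEdges_image_iff hconn] at hT
    refine ⟨_, (isIntBase_dualRank_iff _).2 ⟨_, rfl, hT⟩, ?_⟩
    ext e
    simp [coIndicator]
  · rintro ⟨b, hb, rfl⟩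
    obtain ⟨T, rfl, hT⟩ := (isIntBase_dualRank_iff _).1 hb
    refine ⟨_, (isSpanningTreeEdges_image_iff hconn T).2 hT, ?_⟩
    ext e
    simp [coIndicator]

/-- A spanning two-forest of a connected graph is a spanning tree with an edge removed. -/
theorem IsSpanningTwoForestEdges.exists_insert {V : Type*} {G : SimpleGraph V}
    (hconn : G.Connected) {F : Set (Sym2 V)} (hF : IsSpanningTwoForestEdges G F) :
    ∃ e ∈ G.edgeSet, e ∉ F ∧ IsSpanningTreeEdges G (insert e F) := by
  obtain ⟨hFG, hacyc, hcard⟩ := hF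
  set H := SimpleGraph.fromEdgeSet F with hH
  obtain ⟨u, v, huv, hnot⟩ : ∃ u v, G.Adj u v ∧ ¬ H.Reachable u v := by
    by_contra! h
    have hreach : ∀ u v, H.Reachable u v := fun u v => by
      obtain ⟨p⟩ := hconn.preconnected u v
      induction p with
      | nil => rfl
      | cons hab _ ih => exact (h _ _ hab).trans ih
    obtain ⟨a, b, hab, -⟩ := Nat.card_eq_two_iff.1 hcard
    induction a using SimpleGraph.ConnectedComponent.ind with
    | _ a =>
      induction b using SimpleGraph.ConnectedComponent.ind with
      | _ b => exact hab (SimpleGraph.ConnectedComponent.eq.2 (hreach a b))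
  have hsup : SimpleGraph.fromEdgeSet (insert s(u, v) F) = H ⊔ SimpleGraph.edge u v := by
    rw [hH, SimpleGraph.edge, ← SimpleGraph.fromEdgeSet_union, Set.union_singleton]
  refine ⟨s(u, v), huv, fun h => hnot (SimpleGraph.Adj.reachable ⟨h, huv.ne⟩),
    Set.insert_subset huv hFG, ?_⟩
  rw [hsup]
  refine ⟨?_, hacyc.sup_edge_of_not_reachable hnot⟩
  have hadj : (H ⊔ SimpleGraph.edge u v).Adj u v :=
    Or.inr ((SimpleGraph.edge_adj ..).2 ⟨Or.inl ⟨rfl, rfl⟩, huv.ne⟩)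
  have hu : ∀ w, (H ⊔ SimpleGraph.edge u v).Reachable u w := fun w => by
    obtain ⟨c, -, hc⟩ := (Nat.card_eq_two_iff' (H.connectedComponentMk u)).1 hcard
    by_cases hw : H.connectedComponentMk w = H.connectedComponentMk u
    · exact (SimpleGraph.ConnectedComponent.eq.1 hw).symm.mono le_sup_left
    · have hv : H.connectedComponentMk v ≠ H.connectedComponentMk u := fun h =>
        hnot (SimpleGraph.ConnectedComponent.eq.1 h).symm
      have hvw : H.Reachable v w :=
        SimpleGraph.ConnectedComponent.eq.1 ((hc _ hv).trans (hc _ hw).symm)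
      exact hadj.reachable.trans (hvw.mono le_sup_left)
  have := hconn.nonempty
  exact ⟨fun a b => (hu a).symm.trans (hu b)⟩

/-- The exponent vectors of `U + F` are the sums of a vertex of `P_U` and a vertex of the corner
simplex. -/
theorem massive_exponents_eq_add {V : Type*} {G : SimpleGraph V} (hconn : G.Connected) :
    (({x : G.edgeSet → ℝ | ∃ T, IsSpanningTreeEdges G T ∧ x = coIndicator G T} ∪
          {x : G.edgeSet → ℝ | ∃ (T : Set (Sym2 V)) (j : G.edgeSet),
            IsSpanningTreeEdges G T ∧ x = coIndicator G T + stdVec j}) ∪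
          {x : G.edgeSet → ℝ | ∃ F, IsSpanningTwoForestEdges G F ∧ x = coIndicator G F}) =
      {x : G.edgeSet → ℝ | ∃ T, IsSpanningTreeEdges G T ∧ x = coIndicator G T} +
        ({0} ∪ {x : G.edgeSet → ℝ | ∃ f : G.edgeSet, x = stdVec f}) := by
  ext x
  constructor
  · rintro ((⟨T, hT, rfl⟩ | ⟨T, j, hT, rfl⟩) | ⟨F, hF, rfl⟩)
    · exact ⟨_, ⟨T, hT, rfl⟩, 0, Or.inl rfl, add_zero _⟩
    · exact ⟨_, ⟨T, hT, rfl⟩, _, Or.inr ⟨j, rfl⟩, rfl⟩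
    · obtain ⟨e, he, heF, hT⟩ := hF.exists_insert hconn
      refine ⟨_, ⟨_, hT, rfl⟩, _, Or.inr ⟨⟨e, he⟩, rfl⟩, ?_⟩
      ext i
      by_cases hi : i.1 = e
      · simp [coIndicator, stdVec, Subtype.ext_iff, hi, heF]
      · simp [coIndicator, stdVec, Subtype.ext_iff, hi]
  · rintro ⟨_, ⟨T, hT, rfl⟩, _, rfl | ⟨j, rfl⟩, rfl⟩
    · exact Or.inl (Or.inl ⟨T, hT, add_zero _⟩)
    · exact Or.inl (Or.inr ⟨T, j, hT, rfl⟩)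

/-- The exponent vectors of `U + F` are the projections of the integer points of an integral base
polytope. -/
theorem cobase_add_simplex_eq_image {V : Type*} [Fintype V] {G : SimpleGraph V}
    (hconn : G.Connected) :
    {x : G.edgeSet → ℝ | ∃ T, IsSpanningTreeEdges G T ∧ x = coIndicator G T} +
        ({0} ∪ {x : G.edgeSet → ℝ | ∃ f : G.edgeSet, x = stdVec f}) =
      LinearMap.funLeft ℝ ℝ (some : G.edgeSet → Option G.edgeSet) '' intBaseSet
        ((fun S => dualRank (ZMod 2) (fun e : G.edgeSet => edgeVec e.1) S.eraseNone) +
          unifRankOne) := by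
  have hd := isNormSubmodular_dualRank (K := ZMod 2) fun e : G.edgeSet => edgeVec e.1
  ext x
  constructor
  · rintro ⟨y, hy, z, hz, rfl⟩
    obtain ⟨b, hb, rfl⟩ := (exists_isSpanningTreeEdges_iff hconn).1 hy
    have hb' := (isIntBase_eraseNone_iff hd).2 ⟨b, hb, rfl⟩
    rcases hz with rfl | ⟨j, rfl⟩
    · refine ⟨_, ⟨_, hb'.add (isIntBase_unifRankOne_iff.2 ⟨none, rfl⟩), rfl⟩, ?_⟩
      ext i
      simp
    · refine ⟨_, ⟨_, hb'.add (isIntBase_unifRankOne_iff.2 ⟨some j, rfl⟩), rfl⟩, ?_⟩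
      ext i
      simp [stdVec, Pi.single_apply]
  · rintro ⟨_, ⟨w, hw, rfl⟩, rfl⟩
    obtain ⟨b', c, rfl, hb', hc⟩ := IsIntBase.exists_add (isNormSubmodular_eraseNone hd)
      isNormSubmodular_unifRankOne hw
    obtain ⟨b, hb, rfl⟩ := (isIntBase_eraseNone_iff hd).1 hb'
    obtain ⟨j, rfl⟩ := isIntBase_unifRankOne_iff.1 hc
    refine ⟨_, (exists_isSpanningTreeEdges_iff hconn).2 ⟨b, hb, rfl⟩, ?_⟩
    rcases j with _ | j
    · refine ⟨0, Or.inl rfl, ?_⟩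
      ext i
      simp
    · refine ⟨_, Or.inr ⟨j, rfl⟩, ?_⟩
      ext i
      simp [stdVec, Pi.single_apply]

/-- For a connected graph `G`, the convex hull of the set `A` of exponent
vectors of the massive Lee–Pomeransky polynomial `U + F` equals the Minkowski sum
`P_U + Δ̃_E`, and in particular this convex hull has the integer decomposition property. -/
theorem massive_newton_polytope_eq_and_IDP {V : Type*} [Fintype V] (G : SimpleGraph V)
    (hconn : G.Connected) :
    (convexHull ℝ
        (({x : G.edgeSet → ℝ | ∃ T, IsSpanningTreeEdges G T ∧ x = coIndicator G T} ∪
          {x : G.edgeSet → ℝ | ∃ (T : Set (Sym2 V)) (j : G.edgeSet),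
            IsSpanningTreeEdges G T ∧ x = coIndicator G T + stdVec j}) ∪
          {x : G.edgeSet → ℝ | ∃ F, IsSpanningTwoForestEdges G F ∧ x = coIndicator G F}) =
      (convexHull ℝ {x : G.edgeSet → ℝ | ∃ T, IsSpanningTreeEdges G T ∧ x = coIndicator G T}) +
        convexHull ℝ ({0} ∪ {x : G.edgeSet → ℝ | ∃ f : G.edgeSet, x = stdVec f})) ∧
    HasIDP (convexHull ℝ
        (({x : G.edgeSet → ℝ | ∃ T, IsSpanningTreeEdges G T ∧ x = coIndicator G T} ∪
          {x : G.edgeSet → ℝ | ∃ (T : Set (Sym2 V)) (j : G.edgeSet),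
            IsSpanningTreeEdges G T ∧ x = coIndicator G T + stdVec j}) ∪
          {x : G.edgeSet → ℝ | ∃ F, IsSpanningTwoForestEdges G F ∧ x = coIndicator G F})) := by
  rw [massive_exponents_eq_add hconn]
  refine ⟨convexHull_add _ _, ?_⟩
  rw [cobase_add_simplex_eq_image hconn, ← LinearMap.image_convexHull]
  exact hasIDP_image_convexHull_intBaseSet ((isNormSubmodular_eraseNone
    (isNormSubmodular_dualRank _)).add isNormSubmodular_unifRankOne)
end
end

section
/- Let G be a finite connected simple graph with edge set E that is 2-edge-connected (deleting any single edge leaves it connected). Let P_G = conv({1_{E∖T} : T the edge set of a spanning tree of G} ∪ {1_{E∖F} : F the edge set of a spanning two-forest of G}) ⊆ ℝ^E. Then P_G (the Newton polytope of the Lee–Pomeransky polynomial U + F_0 of the corresponding massless Feynman graph) has the integer decomposition property: for every integer k ≥ 1, (k·P_G) ∩ ℤ^E = ((k−1)·P_G ∩ ℤ^E) + (P_G ∩ ℤ^E). -/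
open scoped Pointwise
open Classical

noncomputable section

/-- The one-sided exchange property of a set of integer vectors. -/
def ExchangeProperty {ι : Type*} (S : Set (ι → ℤ)) : Prop :=
  ∀ x ∈ S, ∀ y ∈ S, ∀ e, y e < x e → ∃ f, x f < y f ∧ x - Pi.single e 1 + Pi.single f 1 ∈ S

/-- The set of all sums of `k` elements of `S`. -/
def sumsOf {ι : Type*} (k : ℕ) (S : Set (ι → ℤ)) : Set (ι → ℤ) :=
  {x | ∃ B : Fin k → ι → ℤ, (∀ i, B i ∈ S) ∧ ∑ i, B i = x}

lemma natAbs_exchange_lt {ι : Type*} [Fintype ι] {b c : ι → ℤ} {e f : ι} (he : c e < b e)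
    (hf : b f < c f) :
    ∑ a, ((b - Pi.single e 1 + Pi.single f 1 : ι → ℤ) a - c a).natAbs <
      ∑ a, (b a - c a).natAbs := by
  have hne : e ≠ f := by rintro rfl; omega
  refine Finset.sum_lt_sum (fun a _ => ?_) ⟨e, Finset.mem_univ _, ?_⟩
  · by_cases h1 : a = e
    · subst h1; simp [hne]; omega
    · by_cases h2 : a = f
      · subst h2; simp [h1]; omega
      · simp [h1, h2]
  · simp [hne]; omega

lemma sum_update_add {ι κ : Type*} [Fintype κ] [DecidableEq κ] (B : κ → ι → ℤ) (j : κ)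
    (z : ι → ℤ) : ∑ i, Function.update B j (B j + z) i = ∑ i, B i + z := by
  rw [Finset.sum_update_of_mem (Finset.mem_univ j), ← Finset.add_sum_erase _ B (Finset.mem_univ j),
    Finset.sdiff_singleton_eq_erase]
  abel

lemma ExchangeProperty.exists_exchange_sumsOf {ι : Type*} [Fintype ι] {S : Set (ι → ℤ)}
    (hS : ExchangeProperty S) {k : ℕ} {x y : ι → ℤ} {e : ι} (hxy : y e < x e)
    {C : Fin k → ι → ℤ} (hC : ∀ i, C i ∈ S) (hCy : ∑ i, C i = y) (n : ℕ) :
    ∀ (B : Fin k → ι → ℤ) (f : ι), ∑ i, ∑ a, (B i a - C i a).natAbs = n →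
      (∀ i, B i ∈ S) → y f ≤ x f → ∑ i, B i = x - Pi.single e 1 + Pi.single f 1 →
      ∃ f, x f < y f ∧ x - Pi.single e 1 + Pi.single f 1 ∈ sumsOf k S := by
  induction n using Nat.strong_induction_on with
  | _ n ih =>
    intro B f hn hB hf hBx
    obtain ⟨j, hj⟩ : ∃ j, C j f < B j f := by
      by_contra! h
      have h1 : (∑ i, B i) f ≤ (∑ i, C i) f := by
        simpa [Finset.sum_apply] using Finset.sum_le_sum fun i _ => h i
      rw [hBx, hCy] at h1
      by_cases hfe : f = e
      · subst hfe; simp at h1; omega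
      · simp [hfe] at h1; omega
    obtain ⟨g, hg, hgS⟩ := hS _ (hB j) _ (hC j) f hj
    set B' := Function.update B j (B j + (Pi.single g 1 - Pi.single f 1)) with hB'
    have hB'j : B' j = B j - Pi.single f 1 + Pi.single g 1 := by simp [hB']; abel
    have hB'i : ∀ i, i ≠ j → B' i = B i := fun i hi => by simp [hB', hi]
    have hB'S : ∀ i, B' i ∈ S := fun i => by
      by_cases hi : i = j
      · subst hi; rwa [hB'j]
      · rw [hB'i i hi]; exact hB i
    have hsB : ∑ i, B' i = x - Pi.single e 1 + Pi.single g 1 := by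
      rw [hB', sum_update_add, hBx]; abel
    by_cases hgxy : x g < y g
    · exact ⟨g, hgxy, ⟨B', hB'S, hsB⟩⟩
    · refine ih _ ?_ B' g rfl hB'S (not_lt.1 hgxy) hsB
      rw [← hn]
      refine Finset.sum_lt_sum (fun i _ => ?_) ⟨j, Finset.mem_univ _, ?_⟩
      · by_cases hi : i = j
        · subst hi; rw [hB'j]; exact (natAbs_exchange_lt hj hg).le
        · rw [hB'i i hi]
      · rw [hB'j]; exact natAbs_exchange_lt hj hg

/-- Minkowski sums preserve the exchange property. -/
lemma ExchangeProperty.exchangeProperty_sumsOf {ι : Type*} [Fintype ι] {S : Set (ι → ℤ)}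
    (hS : ExchangeProperty S) (k : ℕ) : ExchangeProperty (sumsOf k S) := by
  rintro x ⟨B, hB, hBx⟩ y ⟨C, hC, hCy⟩ e hxy
  exact hS.exists_exchange_sumsOf hxy hC hCy _ B e rfl hB hxy.le (by simp [hBx])

lemma ExchangeProperty.sum_le_sum_of_closed {ι : Type*} [Fintype ι] {S : Set (ι → ℤ)}
    (hS : ExchangeProperty S) {s : ι → ℤ} (hs : s ∈ S) {D : Finset ι}
    (hD : ∀ e ∈ D, ∀ f, s - Pi.single e 1 + Pi.single f 1 ∈ S → f ∈ D) (n : ℕ) :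
    ∀ t ∈ S, ∑ a, (t a - s a).natAbs = n → ∑ a ∈ D, s a ≤ ∑ a ∈ D, t a := by
  induction n using Nat.strong_induction_on with
  | _ n ih =>
    intro t ht hn
    by_cases hle : ∀ g ∈ D, t g ≤ s g
    · by_contra! hlt
      obtain ⟨e, he, hes⟩ := Finset.exists_lt_of_sum_lt hlt
      obtain ⟨f, hf, hfS⟩ := hS s hs t ht e hes
      exact (hle f (hD e he f hfS)).not_gt hf
    · push Not at hle
      obtain ⟨g, hgD, hg⟩ := hle
      obtain ⟨h, hh, hhS⟩ := hS t ht s hs g hg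
      refine (ih _ (hn ▸ natAbs_exchange_lt hg hh) _ hhS rfl).trans ?_
      have h1 : ∑ a ∈ D, (Pi.single g 1 : ι → ℤ) a = 1 := by
        rw [Finset.sum_pi_single', if_pos hgD]
      have h2 : ∑ a ∈ D, (Pi.single h 1 : ι → ℤ) a ≤ 1 := by
        rw [Finset.sum_pi_single']; split_ifs <;> norm_num
      simp only [Pi.add_apply, Pi.sub_apply, Finset.sum_add_distrib, Finset.sum_sub_distrib]
      omega

/-- The entrywise cast of an integer vector to a real vector. -/
def castVec {ι : Type*} (x : ι → ℤ) : ι → ℝ := fun i => (x i : ℝ)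

lemma ExchangeProperty.sum_le_sum_of_mem_convexHull {ι : Type*} [Fintype ι] {S : Set (ι → ℤ)}
    (hS : ExchangeProperty S) {s : ι → ℤ} (hs : s ∈ S) {D : Finset ι}
    (hD : ∀ e ∈ D, ∀ f, s - Pi.single e 1 + Pi.single f 1 ∈ S → f ∈ D) {x : ι → ℤ}
    (hx : castVec x ∈ convexHull ℝ (castVec '' S)) : ∑ a ∈ D, s a ≤ ∑ a ∈ D, x a := by
  let l : (ι → ℝ) →ₗ[ℝ] ℝ := ∑ a ∈ D, LinearMap.proj a
  have hl : ∀ y : ι → ℤ, l (castVec y) = ((∑ a ∈ D, y a : ℤ) : ℝ) := fun y => by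
    simp [l, castVec, LinearMap.sum_apply]
  have hsub : convexHull ℝ (castVec '' S) ⊆ {y | ((∑ a ∈ D, s a : ℤ) : ℝ) ≤ l y} := by
    refine convexHull_min ?_ (convex_halfSpace_ge l.isLinear _)
    rintro _ ⟨t, ht, rfl⟩
    simp only [Set.mem_ofPred_eq, hl]
    exact_mod_cast hS.sum_le_sum_of_closed hs hD _ t ht rfl
  have := hsub hx
  simp only [Set.mem_ofPred_eq, hl] at this
  exact_mod_cast this

/-- Unit exchanges out of a fixed vector are transitive. -/
lemma ExchangeProperty.exchange_trans {ι : Type*} {S : Set (ι → ℤ)}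
    (hS : ExchangeProperty S) {s : ι → ℤ} (hs : s ∈ S) {e f g : ι}
    (hef : s - Pi.single e 1 + Pi.single f 1 ∈ S) (hfg : s - Pi.single f 1 + Pi.single g 1 ∈ S) :
    s - Pi.single e 1 + Pi.single g 1 ∈ S := by
  by_cases h1 : e = f
  · rwa [h1]
  by_cases h2 : f = g
  · rwa [← h2]
  by_cases h3 : e = g
  · simpa [h3] using hs
  obtain ⟨h, hh, hhS⟩ := hS _ hfg _ hef e (by simp [h1, h3])
  have hhf : h = f := by
    by_contra hhf
    have h4 : 0 ≤ (Pi.single g 1 : ι → ℤ) h := by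
      rw [Pi.single_apply]; split_ifs <;> norm_num
    have h5 : 0 ≤ (Pi.single e 1 : ι → ℤ) h := by
      rw [Pi.single_apply]; split_ifs <;> norm_num
    simp [hhf] at hh
    omega
  subst hhf
  convert hhS using 1
  abel

lemma ExchangeProperty.mem_of_nearest {ι : Type*} [Fintype ι] {S : Set (ι → ℤ)}
    (hS : ExchangeProperty S) {x : ι → ℤ} (hx : castVec x ∈ convexHull ℝ (castVec '' S))
    (n : ℕ) : ∀ s ∈ S, ∑ a, (s a - x a).natAbs = n → x ∈ S := by
  induction n using Nat.strong_induction_on with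
  | _ n ih =>
    intro s hs hn
    by_cases hle : ∀ e, s e ≤ x e
    · have hsum : ∑ a, x a ≤ ∑ a, s a := by
        let l : (ι → ℝ) →ₗ[ℝ] ℝ := ∑ a, LinearMap.proj a
        have hl : ∀ y : ι → ℤ, l (castVec y) = ((∑ a, y a : ℤ) : ℝ) := fun y => by
          simp [l, castVec, LinearMap.sum_apply]
        have hsub : convexHull ℝ (castVec '' S) ⊆ {y | l y ≤ ((∑ a, s a : ℤ) : ℝ)} := by
          refine convexHull_min ?_ (convex_halfSpace_le l.isLinear _)
          rintro _ ⟨t, ht, rfl⟩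
          simp only [Set.mem_ofPred_eq, hl]
          exact_mod_cast hS.sum_le_sum_of_closed ht (D := Finset.univ)
            (fun _ _ _ _ => Finset.mem_univ _) _ s hs rfl
        have := hsub hx
        simp only [Set.mem_ofPred_eq, hl] at this
        exact_mod_cast this
      have hsx : s = x := funext fun a => (Finset.sum_eq_sum_iff_of_le fun a _ => hle a).1
        ((Finset.sum_le_sum fun a _ => hle a).antisymm hsum) a (Finset.mem_univ a)
      exact hsx ▸ hs
    · push Not at hle
      obtain ⟨e, he⟩ := hle
      let D : Finset ι := {f | s - Pi.single e 1 + Pi.single f 1 ∈ S}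
      have heD : e ∈ D := by simpa [D] using hs
      have hD := hS.sum_le_sum_of_mem_convexHull hs (D := D) (fun f hf g hg => by
        simp only [D, Finset.mem_filter_univ] at hf ⊢
        exact hS.exchange_trans hs hf hg) hx
      obtain ⟨f, hfD, hf⟩ : ∃ f ∈ D, s f < x f := by
        by_contra! h
        exact (Finset.sum_lt_sum h ⟨e, heD, he⟩).not_ge hD
      exact ih _ (hn ▸ natAbs_exchange_lt he hf) _ (by simpa [D] using hfD) rfl

/-- A set of integer vectors with the exchange property contains every integer vector of its
convex hull. -/
lemma ExchangeProperty.mem_of_mem_convexHull {ι : Type*} [Fintype ι] {S : Set (ι → ℤ)}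
    (hS : ExchangeProperty S) {x : ι → ℤ}
    (hx : castVec x ∈ convexHull ℝ (castVec '' S)) : x ∈ S := by
  obtain ⟨_, s, hs, -⟩ := convexHull_nonempty_iff.1 ⟨_, hx⟩
  exact hS.mem_of_nearest hx _ s hs rfl

lemma ExchangeProperty.mem_sumsOf {ι : Type*} [Fintype ι] {S : Set (ι → ℤ)}
    (hS : ExchangeProperty S) {k : ℕ} {x : ι → ℤ}
    (hx : castVec x ∈ (k : ℝ) • convexHull ℝ (castVec '' S)) : x ∈ sumsOf k S := by
  refine (hS.exchangeProperty_sumsOf k).mem_of_mem_convexHull ?_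
  rw [← convexHull_smul] at hx
  refine convexHull_mono ?_ hx
  rintro _ ⟨_, ⟨b, hb, rfl⟩, rfl⟩
  refine ⟨∑ _i : Fin k, b, ⟨fun _ => b, fun _ => hb, rfl⟩, ?_⟩
  funext i
  simp [castVec]

lemma reachable_of_reachable_sup_edge {V : Type*} {G : SimpleGraph V} {u v a b : V}
    (h : (G ⊔ SimpleGraph.edge u v).Reachable a b) :
    G.Reachable a b ∨ (G.Reachable a u ∧ G.Reachable v b) ∨
      (G.Reachable a v ∧ G.Reachable u b) := by
  obtain ⟨p⟩ := h
  induction p with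
  | nil => exact Or.inl (SimpleGraph.Reachable.refl _)
  | @cons x y z hadj p ih =>
    rw [SimpleGraph.sup_adj, SimpleGraph.edge_adj] at hadj
    rcases hadj with hadj | ⟨⟨rfl, rfl⟩ | ⟨rfl, rfl⟩, -⟩
    · have hr := hadj.reachable
      rcases ih with h | ⟨h1, h2⟩ | ⟨h1, h2⟩
      · exact Or.inl (hr.trans h)
      · exact Or.inr (Or.inl ⟨hr.trans h1, h2⟩)
      · exact Or.inr (Or.inr ⟨hr.trans h1, h2⟩)
    · have hx := SimpleGraph.Reachable.refl (G := G) x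
      rcases ih with h | ⟨h1, h2⟩ | ⟨h1, h2⟩
      · exact Or.inr (Or.inl ⟨hx, h⟩)
      · exact Or.inr (Or.inl ⟨hx, h2⟩)
      · exact Or.inl h2
    · have hx := SimpleGraph.Reachable.refl (G := G) x
      rcases ih with h | ⟨h1, h2⟩ | ⟨h1, h2⟩
      · exact Or.inr (Or.inr ⟨hx, h⟩)
      · exact Or.inl h2
      · exact Or.inr (Or.inr ⟨hx, h2⟩)

/-- Joining two components by an edge decreases the number of components by one. -/
lemma card_connectedComponent_sup_edge {V : Type*} [Finite V] {G : SimpleGraph V} {u v : V}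
    (h : ¬ G.Reachable u v) :
    Nat.card (G ⊔ SimpleGraph.edge u v).ConnectedComponent + 1 =
      Nat.card G.ConnectedComponent := by
  have huv : u ≠ v := by rintro rfl; exact h (SimpleGraph.Reachable.refl _)
  have hadj : (G ⊔ SimpleGraph.edge u v).Adj u v := by simp [SimpleGraph.edge_adj, huv]
  have hle : G ≤ G ⊔ SimpleGraph.edge u v := le_sup_left
  let u' := G.connectedComponentMk u
  let φ : {c : G.ConnectedComponent // c ≠ u'} → (G ⊔ SimpleGraph.edge u v).ConnectedComponent :=
    fun c => c.1.map (SimpleGraph.Hom.ofLE hle)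
  have hφ : Function.Bijective φ := by
    constructor
    · rintro ⟨c, hc⟩ ⟨d, hd⟩ hcd
      induction c using SimpleGraph.ConnectedComponent.ind with | _ a =>
      induction d using SimpleGraph.ConnectedComponent.ind with | _ b =>
      have hab : (G ⊔ SimpleGraph.edge u v).Reachable a b :=
        SimpleGraph.ConnectedComponent.eq.1 hcd
      have ha : ¬ G.Reachable a u := fun h => hc (SimpleGraph.ConnectedComponent.eq.2 h)
      have hb : ¬ G.Reachable b u := fun h => hd (SimpleGraph.ConnectedComponent.eq.2 h)
      refine Subtype.ext (SimpleGraph.ConnectedComponent.eq.2 ?_)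
      rcases reachable_of_reachable_sup_edge hab with h | ⟨h, -⟩ | ⟨-, h⟩
      · exact h
      · exact absurd h ha
      · exact absurd h.symm hb
    · intro c
      induction c using SimpleGraph.ConnectedComponent.ind with | _ a =>
      by_cases ha : G.Reachable a u
      · refine ⟨⟨G.connectedComponentMk v, fun h' =>
          h (SimpleGraph.ConnectedComponent.eq.1 h').symm⟩, ?_⟩
        exact SimpleGraph.ConnectedComponent.eq.2 (hadj.symm.reachable.trans (ha.mono hle).symm)
      · exact ⟨⟨G.connectedComponentMk a, fun h' =>
          ha (SimpleGraph.ConnectedComponent.eq.1 h')⟩, rfl⟩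
  rw [← Nat.card_eq_of_bijective φ hφ, ← Nat.card_congr (Equiv.optionSubtypeNe u'),
    Finite.card_option]

lemma edgeSet_sup_edge {V : Type*} {G : SimpleGraph V} {u v : V} (huv : u ≠ v) :
    (G ⊔ SimpleGraph.edge u v).edgeSet = insert s(u, v) G.edgeSet := by
  rw [SimpleGraph.edgeSet_sup, SimpleGraph.edgeSet_edge_of_ne huv, Set.union_comm,
    Set.singleton_union]

/-- In a forest, the numbers of edges and of components add up to the number of vertices. -/
lemma ncard_edgeSet_add_card_connectedComponent {V : Type*} [Finite V] (n : ℕ) :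
    ∀ G : SimpleGraph V, G.IsAcyclic → G.edgeSet.ncard = n →
      G.edgeSet.ncard + Nat.card G.ConnectedComponent = Nat.card V := by
  induction n with
  | zero =>
    intro G hG hn
    rw [Set.ncard_eq_zero, SimpleGraph.edgeSet_eq_empty] at hn
    subst hn
    rw [SimpleGraph.edgeSet_bot, Set.ncard_empty, zero_add]
    refine (Nat.card_eq_of_bijective (SimpleGraph.connectedComponentMk ⊥) ⟨fun a b h => ?_,
      fun c => c.exists_rep⟩).symm
    simpa using SimpleGraph.ConnectedComponent.eq.1 h
  | succ n ih =>
    intro G hG hn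
    obtain ⟨e, he⟩ := (Set.ncard_pos (Set.toFinite _)).1 (by omega : 0 < G.edgeSet.ncard)
    induction e using Sym2.ind with | _ u v =>
    have huv : u ≠ v := G.ne_of_adj he
    have hb := SimpleGraph.isAcyclic_iff_forall_isBridge.1 hG he
    set H := G.deleteEdges {s(u, v)} with hH
    have hr : ¬ H.Reachable u v := SimpleGraph.isBridge_iff.1 hb
    have hGH : H ⊔ SimpleGraph.edge u v = G := by
      rw [← SimpleGraph.edgeSet_inj, edgeSet_sup_edge huv]
      simp [hH, he]
    have hc := card_connectedComponent_sup_edge hr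
    have hnot : s(u, v) ∉ H.edgeSet := by simp [hH]
    have hcard : G.edgeSet.ncard = H.edgeSet.ncard + 1 := by
      rw [← hGH, edgeSet_sup_edge huv, Set.ncard_insert_of_notMem hnot]
    have := ih H (hG.anti (SimpleGraph.deleteEdges_le _)) (by omega)
    rw [hGH] at hc
    omega

lemma SimpleGraph.IsAcyclic.ncard_add_card {V : Type*} [Finite V] {G : SimpleGraph V}
    (hG : G.IsAcyclic) : G.edgeSet.ncard + Nat.card G.ConnectedComponent = Nat.card V :=
  ncard_edgeSet_add_card_connectedComponent _ G hG rfl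

lemma SimpleGraph.IsAcyclic.exists_adj_not_reachable {V : Type*} [Finite V]
    {G H : SimpleGraph V} (hG : G.IsAcyclic) (hH : H.IsAcyclic)
    (hlt : G.edgeSet.ncard < H.edgeSet.ncard) : ∃ u v, H.Adj u v ∧ ¬ G.Reachable u v := by
  by_contra! hcon
  have hreach : ∀ a b, H.Reachable a b → G.Reachable a b := by
    rintro a b ⟨p⟩
    induction p with
    | nil => exact SimpleGraph.Reachable.refl _
    | cons hadj p ih => exact (hcon _ _ hadj).trans ih
  have hle : Nat.card G.ConnectedComponent ≤ Nat.card H.ConnectedComponent := by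
    refine Nat.card_le_card_of_surjective
      (Quot.lift G.connectedComponentMk fun a b h =>
        SimpleGraph.ConnectedComponent.eq.2 (hreach a b h)) fun c => ?_
    obtain ⟨a, rfl⟩ := c.exists_rep
    exact ⟨H.connectedComponentMk a, rfl⟩
  have := hG.ncard_add_card
  have := hH.ncard_add_card
  omega

lemma SimpleGraph.IsAcyclic.isTree_iff_card {V : Type*} [Finite V] [Nonempty V]
    {G : SimpleGraph V} (hG : G.IsAcyclic) :
    G.IsTree ↔ Nat.card G.ConnectedComponent = 1 := by
  rw [SimpleGraph.isTree_iff, and_iff_left hG, Nat.card_eq_one_iff_unique]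
  refine ⟨fun h => ⟨h.preconnected.subsingleton_connectedComponent,
    ⟨G.connectedComponentMk (Classical.arbitrary V)⟩⟩, fun ⟨h, _⟩ => ⟨fun a b => ?_⟩⟩
  exact SimpleGraph.ConnectedComponent.eq.1 (h.elim _ _)

/-- The zero-one indicator vectors of the bases of a matroid. -/
def baseVecs {α : Type*} (M : Matroid α) : Set (α → ℤ) :=
  {x | ∃ X, M.IsBase X ∧ x = fun i => if i ∈ X then 1 else 0}

lemma exchangeProperty_baseVecs {α : Type*} (M : Matroid α) : ExchangeProperty (baseVecs M) := by
  rintro _ ⟨X, hX, rfl⟩ _ ⟨Y, hY, rfl⟩ e he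
  have heX : e ∈ X := by by_contra h; simp only [h, if_false] at he; split_ifs at he <;> omega
  have heY : e ∉ Y := by intro h; simp [h, heX] at he
  obtain ⟨f, ⟨hfY, hfX⟩, hf⟩ := hX.exchange hY ⟨heX, heY⟩
  refine ⟨f, by simp [hfY, hfX], _, hf, ?_⟩
  have hfe : f ≠ e := by rintro rfl; exact hfX heX
  funext i
  by_cases h1 : i = f
  · subst h1; simp [hfX, hfe]
  · by_cases h2 : i = e
    · subst h2; simp [heX, h1]
    · simp [h1, h2]

lemma Convex.sum_mem_smul {E : Type*} [AddCommGroup E] [Module ℝ E] {P : Set E}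
    (hP : Convex ℝ P) (hne : P.Nonempty) (m : ℕ) (v : Fin m → E) (hv : ∀ i, v i ∈ P) :
    ∑ i, v i ∈ (m : ℝ) • P := by
  induction m with
  | zero => simp [Set.zero_smul_set hne]
  | succ m ih =>
    rw [Fin.sum_univ_castSucc, Nat.cast_succ, hP.add_smul (by positivity) zero_le_one, one_smul]
    exact Set.add_mem_add (ih _ fun i => hv _) (hv _)

/-- The polytope obtained from a matroid base polytope by forgetting one coordinate has the
integer decomposition property. -/
lemma hasIDP_convexHull_bases {κ : Type*} [Finite κ] (M : Matroid (Option κ)) :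
    HasIDP (convexHull ℝ
      {x : κ → ℝ | ∃ X, M.IsBase X ∧ x = fun e => if some e ∈ X then 1 else 0}) := by
  have := Fintype.ofFinite κ
  set T := {x : κ → ℝ | ∃ X, M.IsBase X ∧ x = fun e => if some e ∈ X then 1 else 0} with hT
  let π : (Option κ → ℝ) →ₗ[ℝ] (κ → ℝ) := LinearMap.funLeft ℝ ℝ some
  have hconv := convex_convexHull ℝ T
  have hTπ : T = π '' (castVec '' baseVecs M) := by
    ext x
    constructor
    · rintro ⟨X, hX, rfl⟩
      refine ⟨_, ⟨_, ⟨X, hX, rfl⟩, rfl⟩, ?_⟩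
      funext e
      simp [π, castVec, LinearMap.funLeft_apply]
    · rintro ⟨_, ⟨_, ⟨X, hX, rfl⟩, rfl⟩, rfl⟩
      refine ⟨X, hX, ?_⟩
      funext e
      simp [π, castVec, LinearMap.funLeft_apply]
  have hbase : ∀ b ∈ baseVecs M, π (castVec b) ∈ convexHull ℝ T ∩ {x | IsLatticePt x} :=
    fun b hb => ⟨subset_convexHull ℝ T (hTπ ▸ ⟨_, ⟨b, hb, rfl⟩, rfl⟩), fun i => ⟨b (some i), rfl⟩⟩
  intro k hk
  obtain ⟨m, rfl⟩ : ∃ m, k = m + 1 := ⟨k - 1, by omega⟩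
  rw [Nat.add_sub_cancel]
  apply Set.Subset.antisymm
  · rintro _ ⟨⟨p, hp, rfl⟩, hz⟩
    simp only [Set.mem_ofPred_eq] at hz
    have hp' := hp
    rw [hTπ, ← LinearMap.image_convexHull] at hp'
    obtain ⟨q, hq, rfl⟩ := hp'
    obtain ⟨_, b, hb, -⟩ := convexHull_nonempty_iff.1 ⟨_, hq⟩
    have hqsum : ∑ i, q i = ((∑ i, b i : ℤ) : ℝ) := by
      let l : (Option κ → ℝ) →ₗ[ℝ] ℝ := ∑ a, LinearMap.proj a
      have hl : ∀ y, l y = ∑ a, y a := fun y => by simp [l, LinearMap.sum_apply]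
      have hsub : convexHull ℝ (castVec '' baseVecs M) ⊆ {y | l y = ((∑ i, b i : ℤ) : ℝ)} := by
        refine convexHull_min ?_ (convex_hyperplane l.isLinear _)
        rintro _ ⟨t, ht, rfl⟩
        have hS := exchangeProperty_baseVecs M
        have : ∑ i, t i = ∑ i, b i := le_antisymm
          (hS.sum_le_sum_of_closed ht (fun _ _ _ _ => Finset.mem_univ _) _ b hb rfl)
          (hS.sum_le_sum_of_closed hb (fun _ _ _ _ => Finset.mem_univ _) _ t ht rfl)
        simp only [Set.mem_ofPred_eq, hl, castVec]
        exact_mod_cast this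
      simpa [hl] using hsub hq
    choose z hz using hz
    let x : Option κ → ℤ := fun i => i.elim ((m + 1) * ∑ i, b i - ∑ e, z e) z
    have hx : castVec x = ((m + 1 : ℕ) : ℝ) • q := by
      have hsome : ∀ e, (z e : ℝ) = (m + 1) * q (some e) := fun e => by
        rw [← hz]; simp [π, LinearMap.funLeft_apply]
      funext i
      cases i with
      | none =>
        rw [Fintype.sum_option] at hqsum
        simp only [castVec, x, Option.elim_none, Int.cast_sub, Int.cast_mul, ← hqsum, Int.cast_sum,
          hsome, ← Finset.mul_sum, Pi.smul_apply, smul_eq_mul]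
        push_cast
        ring
      | some e => simp [castVec, x, hsome]
    obtain ⟨B, hB, hBx⟩ := (exchangeProperty_baseVecs M).mem_sumsOf
      (hx ▸ Set.smul_mem_smul_set hq :
        castVec x ∈ ((m + 1 : ℕ) : ℝ) • convexHull ℝ (castVec '' baseVecs M))
    refine Set.mem_add.2 ⟨∑ i : Fin m, π (castVec (B i.castSucc)), ⟨?_, ?_⟩,
      π (castVec (B (Fin.last m))), hbase _ (hB _), ?_⟩
    · exact hconv.sum_mem_smul ⟨_, hp⟩ m _ fun i => (hbase _ (hB _)).1
    · intro e
      refine ⟨∑ i : Fin m, B i.castSucc (some e), ?_⟩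
      simp [π, castVec, LinearMap.funLeft_apply, Finset.sum_apply]
    · rw [← Fin.sum_univ_castSucc fun i => π (castVec (B i)), ← map_sum]
      change _ = ((m + 1 : ℕ) : ℝ) • π q
      rw [← map_smul, ← hx, ← hBx]
      congr 1
      funext i
      simp [castVec, Finset.sum_apply]
  · rintro _ ⟨y, ⟨hy, hyl⟩, z, ⟨hz, hzl⟩, rfl⟩
    refine ⟨?_, fun i => ?_⟩
    · rw [Nat.cast_succ, hconv.add_smul (by positivity) zero_le_one, one_smul]
      exact Set.add_mem_add hy hz
    · obtain ⟨a, ha⟩ := hyl i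
      obtain ⟨b, hb⟩ := hzl i
      exact ⟨a + b, by simp [ha, hb]⟩

/-- The edges of `G` occurring in a subset of the edge set with one element added. -/
def edgesOf {V : Type*} {G : SimpleGraph V} (X : Set (Option G.edgeSet)) : Set (Sym2 V) :=
  (↑) '' (some ⁻¹' X : Set G.edgeSet)

lemma edgesOf_subset {V : Type*} {G : SimpleGraph V} (X : Set (Option G.edgeSet)) :
    edgesOf X ⊆ G.edgeSet := by
  rintro _ ⟨e, -, rfl⟩
  exact e.2

lemma edgeSet_fromEdgeSet_of_subset {V : Type*} {G : SimpleGraph V} {T : Set (Sym2 V)}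
    (hT : T ⊆ G.edgeSet) : (SimpleGraph.fromEdgeSet T).edgeSet = T := by
  rw [SimpleGraph.edgeSet_fromEdgeSet, sdiff_eq_left, Set.disjoint_left]
  exact fun e he => G.not_isDiag_of_mem_edgeSet (hT he)

lemma mem_edgesOf {V : Type*} {G : SimpleGraph V} {X : Set (Option G.edgeSet)} {e : G.edgeSet} :
    (e : Sym2 V) ∈ edgesOf X ↔ some e ∈ X := by
  simp [edgesOf]

lemma ncard_eq_ncard_edgesOf {V : Type*} [Finite V] {G : SimpleGraph V}
    (X : Set (Option G.edgeSet)) :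
    X.ncard = (edgesOf X).ncard + if none ∈ X then 1 else 0 := by
  have h1 : (edgesOf X).ncard = (some '' (some ⁻¹' X)).ncard := by
    rw [edgesOf, Set.ncard_image_of_injective _ Subtype.val_injective,
      Set.ncard_image_of_injective _ (Option.some_injective _)]
  rw [h1]
  split_ifs with h
  · rw [← Set.ncard_insert_of_notMem (a := none) (s := some '' (some ⁻¹' X)) (by simp)]
    congr 1
    ext (_ | e) <;> simp [h]
  · congr 1
    ext (_ | e) <;> simp [h]

lemma fromEdgeSet_edgesOf_insert {V : Type*} {G : SimpleGraph V} (X : Set (Option G.edgeSet))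
    {u v : V} (h : s(u, v) ∈ G.edgeSet) :
    SimpleGraph.fromEdgeSet (edgesOf (insert (some ⟨s(u, v), h⟩) X)) =
      SimpleGraph.fromEdgeSet (edgesOf X) ⊔ SimpleGraph.edge u v := by
  rw [← SimpleGraph.edgeSet_inj, edgeSet_sup_edge (G.ne_of_adj h),
    edgeSet_fromEdgeSet_of_subset (edgesOf_subset _),
    edgeSet_fromEdgeSet_of_subset (edgesOf_subset _)]
  ext e
  constructor
  · rintro ⟨e, he, rfl⟩
    simp only [Set.mem_preimage, Set.mem_insert_iff, Option.some_inj] at he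
    rcases he with rfl | he
    · exact Or.inl rfl
    · exact Or.inr ⟨e, he, rfl⟩
  · rintro (rfl | ⟨e, he, rfl⟩)
    · exact ⟨⟨_, h⟩, by simp, rfl⟩
    · exact ⟨e, Or.inr he, rfl⟩

/-- The cycle matroid of `G`, extended by one free coloop and truncated to rank `|V| - 1`. -/
def truncatedForestMatroid {V : Type*} [Finite V] (G : SimpleGraph V) :
    Matroid (Option G.edgeSet) :=
  (IndepMatroid.ofFinite (E := Set.univ) Set.finite_univ
    (fun X => (SimpleGraph.fromEdgeSet (edgesOf X)).IsAcyclic ∧ X.ncard ≤ Nat.card V - 1)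
    (by simp [edgesOf])
    (fun X Y hY hXY => ⟨hY.1.anti (SimpleGraph.fromEdgeSet_mono
      (Set.image_mono (Set.preimage_mono hXY))), (Set.ncard_le_ncard hXY).trans hY.2⟩)
    (fun X Y hX hY hlt => by
      have hcard : ∀ x ∉ X, (insert x X).ncard ≤ Nat.card V - 1 := fun x hx => by
        rw [Set.ncard_insert_of_notMem hx]
        exact hlt.trans_le hY.2
      by_cases hlt' : (edgesOf X).ncard < (edgesOf Y).ncard
      · rw [← edgeSet_fromEdgeSet_of_subset (edgesOf_subset X),
          ← edgeSet_fromEdgeSet_of_subset (edgesOf_subset Y)] at hlt'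
        obtain ⟨u, v, huv, hnr⟩ := hX.1.exists_adj_not_reachable hY.1 hlt'
        rw [SimpleGraph.fromEdgeSet_adj] at huv
        have hG := edgesOf_subset Y huv.1
        have hnX : some ⟨s(u, v), hG⟩ ∉ X := fun h => hnr <| SimpleGraph.Adj.reachable <|
          (SimpleGraph.fromEdgeSet_adj _).2 ⟨mem_edgesOf.2 h, huv.2⟩
        refine ⟨some ⟨s(u, v), hG⟩, mem_edgesOf.1 huv.1, hnX, ?_, hcard _ hnX⟩
        rw [fromEdgeSet_edgesOf_insert]
        exact hX.1.sup_edge_of_not_reachable hnr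
      · rw [ncard_eq_ncard_edgesOf X, ncard_eq_ncard_edgesOf Y] at hlt
        have hY0 : none ∈ Y := by by_contra h; simp [h] at hlt; omega
        have hX0 : none ∉ X := by intro h; simp [h, hY0] at hlt; omega
        refine ⟨none, hY0, hX0, ?_, hcard _ hX0⟩
        have : edgesOf (insert none X) = edgesOf X := by
          ext e
          simp [edgesOf]
        rw [this]
        exact hX.1)
    (fun _ _ => Set.subset_univ _)).matroid

lemma truncatedForestMatroid_indep {V : Type*} [Finite V] {G : SimpleGraph V}
    {X : Set (Option G.edgeSet)} : (truncatedForestMatroid G).Indep X ↔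
      (SimpleGraph.fromEdgeSet (edgesOf X)).IsAcyclic ∧ X.ncard ≤ Nat.card V - 1 :=
  Iff.rfl

lemma edgesOf_preimage {V : Type*} {G : SimpleGraph V} {T : Set (Sym2 V)} (hT : T ⊆ G.edgeSet)
    {X : Set (Option G.edgeSet)} (hX : ∀ e : G.edgeSet, some e ∈ X ↔ (e : Sym2 V) ∈ T) :
    edgesOf X = T := by
  ext e
  constructor
  · rintro ⟨e, he, rfl⟩
    exact (hX e).1 he
  · exact fun he => ⟨⟨e, hT he⟩, (hX _).2 he, rfl⟩

lemma truncatedForestMatroid_isBase {V : Type*} [Finite V] {G : SimpleGraph V}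
    (hconn : G.Connected) {X : Set (Option G.edgeSet)} :
    (truncatedForestMatroid G).IsBase X ↔
      (SimpleGraph.fromEdgeSet (edgesOf X)).IsAcyclic ∧ X.ncard = Nat.card V - 1 := by
  have hmax : ∀ X, (truncatedForestMatroid G).Indep X → X.ncard = Nat.card V - 1 →
      (truncatedForestMatroid G).IsBase X := fun X hX hc =>
    hX.isBase_of_maximal fun J hJ hXJ =>
      Set.eq_of_subset_of_ncard_le hXJ ((truncatedForestMatroid_indep.1 hJ).2.trans hc.ge)
  obtain ⟨T, hTG, hT⟩ := hconn.exists_isTree_le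
  have hTG' : T.edgeSet ⊆ G.edgeSet := SimpleGraph.edgeSet_mono hTG
  set B : Set (Option G.edgeSet) := some '' {e | (e : Sym2 V) ∈ T.edgeSet} with hB
  have hBT : edgesOf B = T.edgeSet := edgesOf_preimage hTG' (by simp [hB])
  have hBcard : B.ncard = Nat.card V - 1 := by
    rw [ncard_eq_ncard_edgesOf, hBT, if_neg (by simp [hB])]
    have := (SimpleGraph.isTree_iff_connected_and_card.1 hT).2
    rw [Nat.card_coe_set_eq] at this
    omega
  have hBbase := hmax B (truncatedForestMatroid_indep.2
    ⟨by rw [hBT, SimpleGraph.fromEdgeSet_edgeSet]; exact hT.isAcyclic, hBcard.le⟩) hBcard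
  constructor
  · exact fun h => ⟨(truncatedForestMatroid_indep.1 h.indep).1,
      (h.ncard_eq_ncard_of_isBase hBbase).trans hBcard⟩
  · exact fun h => hmax X (truncatedForestMatroid_indep.2 ⟨h.1, h.2.le⟩) h.2

lemma truncatedForestMatroid_isBase_iff {V : Type*} [Finite V] {G : SimpleGraph V}
    (hconn : G.Connected) {X : Set (Option G.edgeSet)} :
    (truncatedForestMatroid G).IsBase X ↔
      (none ∉ X ∧ IsSpanningTreeEdges G (edgesOf X)) ∨
        (none ∈ X ∧ IsSpanningTwoForestEdges G (edgesOf X)) := by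
  have := hconn.nonempty
  have hpos : 0 < Nat.card V := Nat.card_pos
  rw [truncatedForestMatroid_isBase hconn, ncard_eq_ncard_edgesOf, IsSpanningTreeEdges,
    IsSpanningTwoForestEdges, and_iff_right (edgesOf_subset X), and_iff_right (edgesOf_subset X)]
  by_cases hac : (SimpleGraph.fromEdgeSet (edgesOf X)).IsAcyclic
  · have hc := hac.ncard_add_card
    rw [edgeSet_fromEdgeSet_of_subset (edgesOf_subset X)] at hc
    have : 0 < Nat.card (SimpleGraph.fromEdgeSet (edgesOf X)).ConnectedComponent :=
      have : Nonempty (SimpleGraph.fromEdgeSet (edgesOf X)).ConnectedComponent :=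
        ⟨SimpleGraph.connectedComponentMk _ (Classical.arbitrary V)⟩
      Nat.card_pos
    rw [hac.isTree_iff_card]
    by_cases h0 : none ∈ X
    · simp [h0, hac]; omega
    · simp [h0, hac]; omega
  · have : ¬ (SimpleGraph.fromEdgeSet (edgesOf X)).IsTree := fun h => hac h.isAcyclic
    simp [hac, this]

/-- For a 2-edge-connected graph `G`, the Newton polytope of the massless
Lee–Pomeransky polynomial `U + F₀`, i.e. the convex hull of the indicator vectors `1_{E∖T}`
(spanning trees `T`) and `1_{E∖F}` (spanning two-forests `F`), has the integer decomposition
property. -/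
theorem massless_symanzik_polytope_IDP {V : Type*} [Fintype V] (G : SimpleGraph V)
    (hconn : G.Connected)
    (h2ec : ∀ e ∈ G.edgeSet, (G.deleteEdges {e}).Connected) :
    HasIDP (convexHull ℝ
      ({x : G.edgeSet → ℝ | ∃ T, IsSpanningTreeEdges G T ∧ x = coIndicator G T} ∪
        {x : G.edgeSet → ℝ | ∃ F, IsSpanningTwoForestEdges G F ∧ x = coIndicator G F})) := by
  convert hasIDP_convexHull_bases (truncatedForestMatroid G)✶ using 2
  have hset : ∀ X : Set (Option G.edgeSet),
      (fun e => if some e ∈ X then 1 else 0) = coIndicator G (edgesOf Xᶜ) := fun X => by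
    funext e
    by_cases h : some e ∈ X <;> simp [coIndicator, mem_edgesOf, h]
  have hE : (truncatedForestMatroid G).E = Set.univ := rfl
  have hdual : ∀ X, (truncatedForestMatroid G)✶.IsBase X ↔ (truncatedForestMatroid G).IsBase Xᶜ :=
    fun X => by rw [Matroid.dual_isBase_iff (by simp [hE]), hE, Set.compl_eq_univ_sdiff]
  ext x
  constructor
  · rintro (⟨T, hT, rfl⟩ | ⟨F, hF, rfl⟩)
    · let X : Set (Option G.edgeSet) := some '' {e | (e : Sym2 V) ∈ T}
      have hX : edgesOf X = T := edgesOf_preimage hT.1 (by simp [X])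
      refine ⟨Xᶜ, ?_, by rw [hset, compl_compl, hX]⟩
      rw [hdual, compl_compl, truncatedForestMatroid_isBase_iff hconn, hX]
      exact Or.inl ⟨by simp [X], hT⟩
    · let X : Set (Option G.edgeSet) := insert none (some '' {e | (e : Sym2 V) ∈ F})
      have hX : edgesOf X = F := edgesOf_preimage hF.1 (by simp [X])
      refine ⟨Xᶜ, ?_, by rw [hset, compl_compl, hX]⟩
      rw [hdual, compl_compl, truncatedForestMatroid_isBase_iff hconn, hX]
      exact Or.inr ⟨by simp [X], hF⟩
  · rintro ⟨X, hX, rfl⟩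
    rw [hdual, truncatedForestMatroid_isBase_iff hconn] at hX
    rcases hX with ⟨-, h⟩ | ⟨-, h⟩
    · exact Or.inl ⟨_, h, hset X⟩
    · exact Or.inr ⟨_, h, hset X⟩
end
end
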